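/- arXiv:math/0304205 — 4 statements merged into one kernel-verified Lean document; each statement's English description precedes it below -/
import Mathlib

section
/- Let G be a simple graph on vertex set ℕ satisfying the extension property. In the automorphism group Aut(G), equipped with the topology of pointwise convergence, there exists an element whose conjugacy class is comeagre (i.e. contains a countable intersection of dense open subsets). -/
/-- A simple graph on `ℕ` has the extension property (i.e. is a Rado graph) if for all
disjoint finite sets `A`, `B` of vertices there is a vertex outside `A ∪ B` adjacent to
every vertex of `A` and to no vertex of `B`. -/
def SimpleGraph.ExtensionProperty (G : SimpleGraph ℕ) : Prop :=
  ∀ A B : Finset ℕ, Disjoint A B →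
    ∃ v : ℕ, v ∉ A ∪ B ∧ (∀ a ∈ A, G.Adj v a) ∧ ∀ b ∈ B, ¬G.Adj v b

/-- The topology of pointwise convergence on `Aut(G)`: the topology induced from the
product topology on `ℕ → ℕ`, where `ℕ` is discrete. -/
def graphAutPointwiseTopology (G : SimpleGraph ℕ) : TopologicalSpace (G ≃g G) :=
  TopologicalSpace.induced (fun g : G ≃g G => (g : ℕ → ℕ))
    (@Pi.topologicalSpace ℕ (fun _ => ℕ) (fun _ => ⊥))


namespace RadoGeneric

open Topology

/-- A finite set of pairs that is a partial isomorphism of `G`. -/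
def PIso (G : SimpleGraph ℕ) (s : Finset (ℕ × ℕ)) : Prop :=
  ∀ x ∈ s, ∀ y ∈ s, (x.1 = y.1 ↔ x.2 = y.2) ∧ (G.Adj x.1 y.1 ↔ G.Adj x.2 y.2)

/-- Abstract back-and-forth. -/
theorem back_forth (P : Finset (ℕ × ℕ) → Prop)
    (hinj : ∀ s, P s → ∀ x ∈ s, ∀ y ∈ s, (x.1 = y.1 ↔ x.2 = y.2))
    (hforth : ∀ s, P s → ∀ n, ∃ t, s ⊆ t ∧ P t ∧ ∃ m, (n, m) ∈ t)
    (hback : ∀ s, P s → ∀ m, ∃ t, s ⊆ t ∧ P t ∧ ∃ n, (n, m) ∈ t)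
    (s : Finset (ℕ × ℕ)) (hs : P s) :
    ∃ e : ℕ ≃ ℕ, (∀ x ∈ s, e x.1 = x.2) ∧
      ∀ a b, ∃ t, P t ∧ (a, e a) ∈ t ∧ (b, e b) ∈ t ∧ ∀ x ∈ t, e x.1 = x.2 := by
  have step : ∀ n, ∀ s : {s // P s}, ∃ t : {s // P s}, s.1 ⊆ t.1 ∧ (∃ m, (n, m) ∈ t.1) ∧
      ∃ m, (m, n) ∈ t.1 := by
    rintro n ⟨s, hs⟩
    obtain ⟨t, h1, h2, m, hm⟩ := hforth s hs n
    obtain ⟨u, h3, h4, m', hm'⟩ := hback t h2 n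
    exact ⟨⟨u, h4⟩, h1.trans h3, ⟨m, h3 hm⟩, ⟨m', hm'⟩⟩
  choose F hF1 hF2 hF3 using step
  let c : ℕ → {s // P s} := fun n => Nat.rec ⟨s, hs⟩ (fun n t => F n t) n
  have cs : ∀ n, c (n + 1) = F n (c n) := fun n => rfl
  have mono : Monotone (fun n => (c n).1) := by
    apply monotone_nat_of_le_succ
    intro n
    rw [cs]
    exact hF1 n (c n)
  have f1 : ∀ n, ∃ m, (n, m) ∈ (c (n+1)).1 := fun n => hF2 n (c n)
  have f2 : ∀ n, ∃ m, (m, n) ∈ (c (n+1)).1 := fun n => hF3 n (c n)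
  choose f hf using f1
  choose f' hf' using f2
  have key : ∀ i j x y, x ∈ (c i).1 → y ∈ (c j).1 → (x.1 = y.1 ↔ x.2 = y.2) := by
    intro i j x y hx hy
    exact hinj _ (c (max i j)).2 x (mono (le_max_left i j) hx) y (mono (le_max_right i j) hy)
  have hfx : ∀ i, ∀ x ∈ (c i).1, f x.1 = x.2 := by
    intro i x hx
    exact (key (x.1 + 1) i (x.1, f x.1) x (hf x.1) hx).1 rfl
  let e : ℕ ≃ ℕ :=
    { toFun := f
      invFun := f'
      left_inv := fun n => (key (f n + 1) (n + 1) (f' (f n), f n) (n, f n) (hf' (f n)) (hf n)).2 rfl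
      right_inv := fun n => (key (f' n + 1) (n + 1) (f' n, f (f' n)) (f' n, n) (hf (f' n)) (hf' n)).1 rfl }
  refine ⟨e, hfx 0, fun a b => ⟨(c (max (a+1) (b+1))).1, (c _).2, ?_, ?_, hfx _⟩⟩
  · exact mono (le_max_left _ _) (hf a)
  · exact mono (le_max_right _ _) (hf b)

theorem PIso.swap {G : SimpleGraph ℕ} {s : Finset (ℕ × ℕ)} (h : PIso G s) :
    PIso G (s.image Prod.swap) := by
  intro x hx y hy
  simp only [Finset.mem_image] at hx hy
  obtain ⟨x, hx, rfl⟩ := hx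
  obtain ⟨y, hy, rfl⟩ := hy
  exact ⟨(h x hx y hy).1.symm, (h x hx y hy).2.symm⟩

theorem PIso.forth {G : SimpleGraph ℕ} (hG : G.ExtensionProperty) {s : Finset (ℕ × ℕ)}
    (h : PIso G s) (n : ℕ) : ∃ t, s ⊆ t ∧ PIso G t ∧ ∃ m, (n, m) ∈ t := by
  classical
  by_cases hn : ∃ m, (n, m) ∈ s
  · exact ⟨s, subset_rfl, h, hn⟩
  push Not at hn
  obtain ⟨v, hv, hA, hB⟩ := hG ((s.filter (fun x => G.Adj n x.1)).image Prod.snd)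
    ((s.filter (fun x => ¬ G.Adj n x.1)).image Prod.snd) (by
      rw [Finset.disjoint_left]
      intro b hb hb'
      simp only [Finset.mem_image, Finset.mem_filter] at hb hb'
      obtain ⟨x, ⟨hx, hx'⟩, rfl⟩ := hb
      obtain ⟨y, ⟨hy, hy'⟩, e⟩ := hb'
      have := (h y hy x hx).1.2 e
      rw [this] at hy'
      exact hy' hx')
  have hA' : ∀ x ∈ s, (G.Adj n x.1 ↔ G.Adj v x.2) := by
    intro x hx
    constructor
    · intro hh
      exact hA _ (Finset.mem_image_of_mem _ (Finset.mem_filter.2 ⟨hx, hh⟩))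
    · intro hh
      by_contra hc
      exact hB _ (Finset.mem_image_of_mem _ (Finset.mem_filter.2 ⟨hx, hc⟩)) hh
  have hv' : ∀ x ∈ s, v ≠ x.2 := by
    intro x hx e
    apply hv
    rw [e, Finset.mem_union]
    by_cases hc : G.Adj n x.1
    · exact Or.inl (Finset.mem_image_of_mem _ (Finset.mem_filter.2 ⟨hx, hc⟩))
    · exact Or.inr (Finset.mem_image_of_mem _ (Finset.mem_filter.2 ⟨hx, hc⟩))
  have hn' : ∀ x ∈ s, n ≠ x.1 := by
    rintro ⟨a, b⟩ hx rfl
    exact hn b hx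
  refine ⟨insert (n, v) s, Finset.subset_insert _ _, ?_, v, Finset.mem_insert_self _ _⟩
  intro x hx y hy
  rw [Finset.mem_insert] at hx hy
  rcases hx with rfl | hx <;> rcases hy with rfl | hy
  · simp
  · exact ⟨by simp [hn' y hy, hv' y hy], hA' y hy⟩
  · refine ⟨by simp [(hn' x hx).symm, (hv' x hx).symm], ?_⟩
    rw [G.adj_comm, G.adj_comm x.2]
    exact hA' x hx
  · exact h x hx y hy

/-- Homogeneity. -/
theorem homog {G : SimpleGraph ℕ} (hG : G.ExtensionProperty) {s : Finset (ℕ × ℕ)}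
    (h : PIso G s) : ∃ e : G ≃g G, ∀ x ∈ s, e x.1 = x.2 := by
  classical
  obtain ⟨e, he, he'⟩ := back_forth (PIso G) (fun s hs x hx y hy => (hs x hx y hy).1)
    (fun s hs n => hs.forth hG n) (by
      intro s hs m
      obtain ⟨t, h1, h2, n, hn⟩ := hs.swap.forth hG m
      refine ⟨t.image Prod.swap, ?_, h2.swap, n, ?_⟩
      · intro x hx
        exact Finset.mem_image.2 ⟨x.swap, h1 (Finset.mem_image_of_mem _ hx), by simp⟩
      · exact Finset.mem_image.2 ⟨(m, n), hn, rfl⟩) s h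
  refine ⟨⟨e, ?_⟩, he⟩
  intro a b
  obtain ⟨t, ht, ha, hb, -⟩ := he' a b
  exact ((ht _ ha _ hb).2).symm

/-- Homogeneity, indexed form. -/
theorem homog' {G : SimpleGraph ℕ} (hG : G.ExtensionProperty) {W : Type*} [Finite W]
    (p q : W → ℕ) (h1 : ∀ v w, p v = p w ↔ q v = q w)
    (h2 : ∀ v w, G.Adj (p v) (p w) ↔ G.Adj (q v) (q w)) :
    ∃ e : G ≃g G, ∀ w, e (p w) = q w := by
  classical
  haveI := Fintype.ofFinite W
  obtain ⟨e, he⟩ := homog hG (s := Finset.univ.image (fun w => (p w, q w))) (by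
    intro x hx y hy
    simp only [Finset.mem_image, Finset.mem_univ, true_and] at hx hy
    obtain ⟨v, rfl⟩ := hx
    obtain ⟨w, rfl⟩ := hy
    exact ⟨h1 v w, h2 v w⟩)
  exact ⟨e, fun w => he (p w, q w) (Finset.mem_image_of_mem _ (Finset.mem_univ _))⟩

/-- Embedding a finite graph with prescribed adjacency to a finite set. -/
theorem embed {G : SimpleGraph ℕ} (hG : G.ExtensionProperty) {W : Type*} [Finite W]
    (H : SimpleGraph W) (C : Finset ℕ) (R : W → ℕ → Prop) :
    ∃ f : W → ℕ, Function.Injective f ∧ (∀ w, f w ∉ C) ∧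
      (∀ v w, G.Adj (f v) (f w) ↔ H.Adj v w) ∧ ∀ w, ∀ c ∈ C, (G.Adj (f w) c ↔ R w c) := by
  classical
  haveI := Fintype.ofFinite W
  have main : ∀ T : Finset W, ∃ f : W → ℕ, Set.InjOn f T ∧ (∀ w ∈ T, f w ∉ C) ∧
      (∀ v ∈ T, ∀ w ∈ T, (G.Adj (f v) (f w) ↔ H.Adj v w)) ∧
      ∀ w ∈ T, ∀ c ∈ C, (G.Adj (f w) c ↔ R w c) := by
    intro T
    induction T using Finset.induction_on with
    | empty => exact ⟨fun _ => 0, by simp⟩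
    | insert w T hw ih =>
      obtain ⟨f, h1, h2, h3, h4⟩ := ih
      obtain ⟨v, hv, hA, hB⟩ := hG (C.filter (R w) ∪ (T.filter (H.Adj w)).image f)
        (C.filter (fun c => ¬ R w c) ∪ (T.filter (fun t => ¬ H.Adj w t)).image f) (by
          rw [Finset.disjoint_left]
          intro b hb hb'
          simp only [Finset.mem_union, Finset.mem_image, Finset.mem_filter] at hb hb'
          rcases hb with hb | ⟨x, ⟨hx, hx'⟩, rfl⟩ <;> rcases hb' with hb' | ⟨y, ⟨hy, hy'⟩, e⟩
          · exact hb'.2 hb.2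
          · exact h2 y hy (e ▸ hb.1)
          · exact h2 x hx hb'.1
          · exact hy' (h1 hx hy e.symm ▸ hx'))
      simp only [Finset.mem_union, Finset.mem_image, Finset.mem_filter] at hv hA hB
      have vC : v ∉ C := by
        intro hc
        by_cases hr : R w v <;> tauto
      have vT : ∀ t ∈ T, v ≠ f t := by
        rintro t ht rfl
        by_cases hr : H.Adj w t
        · exact hv (Or.inl (Or.inr ⟨t, ⟨ht, hr⟩, rfl⟩))
        · exact hv (Or.inr (Or.inr ⟨t, ⟨ht, hr⟩, rfl⟩))
      have aC : ∀ c ∈ C, (G.Adj v c ↔ R w c) := by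
        intro c hc
        refine ⟨fun h => ?_, fun h => hA c (Or.inl ⟨hc, h⟩)⟩
        by_contra hr
        exact hB c (Or.inl ⟨hc, hr⟩) h
      have aT : ∀ t ∈ T, (G.Adj v (f t) ↔ H.Adj w t) := by
        intro t ht
        refine ⟨fun h => ?_, fun h => hA _ (Or.inr ⟨t, ⟨ht, h⟩, rfl⟩)⟩
        by_contra hr
        exact hB _ (Or.inr ⟨t, ⟨ht, hr⟩, rfl⟩) h
      have ne : ∀ t ∈ T, t ≠ w := fun t ht e => hw (e ▸ ht)
      have fw : Function.update f w v w = v := Function.update_self ..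
      have ft : ∀ t ∈ T, Function.update f w v t = f t :=
        fun t ht => Function.update_of_ne (ne t ht) ..
      refine ⟨Function.update f w v, ?_, ?_, ?_, ?_⟩
      · intro x hx y hy e
        simp only [Finset.coe_insert, Set.mem_insert_iff, Finset.mem_coe] at hx hy
        rcases hx with rfl | hx <;> rcases hy with rfl | hy
        · rfl
        · rw [fw, ft y hy] at e
          exact absurd e (vT y hy)
        · rw [fw, ft x hx] at e
          exact absurd e.symm (vT x hx)
        · rw [ft x hx, ft y hy] at e
          exact h1 hx hy e
      · intro x hx
        rcases Finset.mem_insert.1 hx with rfl | hx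
        · rwa [fw]
        · rw [ft x hx]; exact h2 x hx
      · intro x hx y hy
        rw [Finset.mem_insert] at hx hy
        rcases hx with rfl | hx <;> rcases hy with rfl | hy
        · simp
        · rw [fw, ft y hy]; exact aT y hy
        · rw [fw, ft x hx, G.adj_comm, H.adj_comm]; exact aT x hx
        · rw [ft x hx, ft y hy]; exact h3 x hx y hy
      · intro x hx
        rcases Finset.mem_insert.1 hx with rfl | hx
        · rw [fw]; exact aC
        · rw [ft x hx]; exact h4 x hx
  obtain ⟨f, h1, h2, h3, h4⟩ := main Finset.univ
  exact ⟨f, fun x y e => h1 (by simp) (by simp) e, fun w => h2 w (by simp),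
    fun v w => h3 v (by simp) w (by simp), fun w => h4 w (by simp)⟩

/-- The valuation graph. -/
def valGraph (V : Type) : SimpleGraph (V × (V → Bool)) where
  Adj x y := x.1 ≠ y.1 ∧ x.2 y.1 ≠ y.2 x.1
  symm := ⟨fun _ _ h => ⟨h.1.symm, h.2.symm⟩⟩
  loopless := ⟨fun _ h => h.1 rfl⟩

/-- Extension property for one partial automorphism. -/
theorem eppa {G : SimpleGraph ℕ} (hG : G.ExtensionProperty) (g : G ≃g G) (S : Finset ℕ) :
    ∃ (h : G ≃g G) (C : Finset ℕ), S ⊆ C ∧ (∀ c ∈ C, h c ∈ C) ∧ ∀ x ∈ S, h x = g x := by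
  classical
  let V : Finset ℕ := S ∪ S.image g
  have hgV : ∀ x ∈ S, g x ∈ V := fun x hx =>
    Finset.mem_union_right _ (Finset.mem_image_of_mem _ hx)
  obtain ⟨π, hπ⟩ := Finset.exists_equiv_extend_of_card_eq (α := V) (t := V)
    (Fintype.card_coe V) (s := Finset.univ.filter (fun v : V => (v : ℕ) ∈ S))
    (f := fun v => g v) (by
      intro y hy
      simp only [Finset.mem_image, Finset.mem_filter] at hy
      obtain ⟨x, hx, rfl⟩ := hy
      exact hgV _ hx.2) (by
      intro x _ y _ e
      exact Subtype.ext (g.injective e))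
  have hπ' : ∀ v : V, (v : ℕ) ∈ S → (π v : ℕ) = g v := fun v hv => hπ v (by simpa using hv)
  let χ : V → V → Bool := fun v u => decide ((u : ℕ) < v ∧ G.Adj u v)
  have hχ : ∀ v u : V, xor (χ v u) (χ u v) = decide (G.Adj v u) := by
    intro v u
    simp only [χ]
    rw [G.adj_comm (u : ℕ)]
    rcases lt_trichotomy (u : ℕ) v with h | h | h
    · simp [h, h.not_gt]
    · simp [h]
    · simp [h, h.not_gt]
  let F : V → V → Bool := fun v u =>
    if (v : ℕ) ∈ S then xor (χ (π v) (π u)) (χ v u)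
    else if (u : ℕ) ∈ S then xor (χ (π u) (π v)) (χ u v) else false
  have hF : ∀ v u, F v u = F u v := by
    intro v u
    simp only [F]
    by_cases hv : (v : ℕ) ∈ S <;> by_cases hu : (u : ℕ) ∈ S
    · simp only [hv, hu, if_true]
      have e1 := hχ v u
      have e2 := hχ (π v) (π u)
      rw [hπ' v hv, hπ' u hu] at e2
      have e3 : decide (G.Adj (g v) (g u)) = decide (G.Adj v u) := by
        rw [g.map_adj_iff]
      rw [e3, ← e1] at e2
      revert e2
      cases χ (π v) (π u) <;> cases χ (π u) (π v) <;> cases χ v u <;> cases χ u v <;> simp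
    all_goals simp [hv, hu]
  let θ : V × (V → Bool) → V × (V → Bool) := fun x =>
    (π x.1, fun w => xor (x.2 (π.symm w)) (F x.1 (π.symm w)))
  have θinj : Function.Injective θ := by
    rintro ⟨v, a⟩ ⟨u, b⟩ e
    simp only [θ, Prod.mk.injEq] at e
    obtain ⟨e1, e2⟩ := e
    have := π.injective e1
    subst this
    congr 1
    funext w
    have := congrFun e2 (π w)
    simpa using this
  have θadj : ∀ x y, (valGraph V).Adj (θ x) (θ y) ↔ (valGraph V).Adj x y := by
    rintro ⟨v, a⟩ ⟨u, b⟩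
    simp only [θ, valGraph, Equiv.symm_apply_apply, ne_eq, π.injective.eq_iff]
    rw [hF u v]
    cases a u <;> cases b v <;> cases F v u <;> simp
  let j : V → V × (V → Bool) := fun v => (v, χ v)
  have jadj : ∀ v u, (valGraph V).Adj (j v) (j u) ↔ G.Adj v u := by
    intro v u
    have := hχ v u
    simp only [j, valGraph]
    constructor
    · rintro ⟨-, h⟩
      revert this h
      cases χ v u <;> cases χ u v <;> simp
    · intro h
      refine ⟨fun e => G.ne_of_adj h (congrArg _ e), ?_⟩
      revert this
      simp only [h]
      cases χ v u <;> cases χ u v <;> simp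
  have jθ : ∀ v : V, (v : ℕ) ∈ S → θ (j v) = j (π v) := by
    intro v hv
    simp only [θ, j]
    congr 1
    funext w
    simp only [F, hv, if_true, Equiv.apply_symm_apply]
    cases χ (π v) w <;> cases χ v (π.symm w) <;> rfl
  obtain ⟨f, f1, -, f3, -⟩ := embed hG (valGraph V) ∅ (fun _ _ => True)
  obtain ⟨φ, hφ⟩ := homog' hG (fun v : V => f (j v)) (fun v : V => (v : ℕ)) (by
    intro v w
    rw [f1.eq_iff]
    constructor
    · intro e; exact congrArg (fun x => (x.1 : ℕ)) e
    · intro e; rw [Subtype.ext e]) (by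
    intro v w
    rw [f3, jadj])
  obtain ⟨h, hh⟩ := homog' hG (fun x => φ (f x)) (fun x => φ (f (θ x))) (by
    intro x y
    rw [φ.injective.eq_iff, φ.injective.eq_iff, f1.eq_iff, f1.eq_iff, θinj.eq_iff]) (by
    intro x y
    rw [φ.map_adj_iff, φ.map_adj_iff, f3, f3, θadj])
  have SV : ∀ x ∈ S, x ∈ V := fun x hx => Finset.mem_union_left _ hx
  refine ⟨h, Finset.univ.image (fun x => φ (f x)), ?_, ?_, ?_⟩
  · intro x hx
    exact Finset.mem_image.2 ⟨j ⟨x, SV x hx⟩, Finset.mem_univ _, hφ ⟨x, SV x hx⟩⟩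
  · intro c hc
    obtain ⟨x, -, rfl⟩ := Finset.mem_image.1 hc
    rw [hh]
    exact Finset.mem_image_of_mem _ (Finset.mem_univ _)
  · intro x hx
    have e1 := hφ ⟨x, SV x hx⟩
    have e2 := hh (j ⟨x, SV x hx⟩)
    simp only at e1 e2
    rw [e1, jθ _ hx] at e2
    rw [e2, ← hπ' ⟨x, SV x hx⟩ hx]
    exact hφ _

theorem inv_mem {G : SimpleGraph ℕ} (k : G ≃g G) (A : Finset ℕ) (h : ∀ a ∈ A, k a ∈ A)
    (a : ℕ) (ha : k a ∈ A) : a ∈ A := by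
  classical
  have : A.image k = A := Finset.eq_of_subset_of_card_le
    (Finset.image_subset_iff.2 h) (Finset.card_image_of_injective _ k.injective).ge
  rw [← this] at ha
  obtain ⟨b, hb, e⟩ := Finset.mem_image.1 ha
  rwa [← k.injective e]

/-- Amalgamation. -/
theorem amalg {G : SimpleGraph ℕ} (hG : G.ExtensionProperty) (A B : Finset ℕ) (k : G ≃g G)
    (hA : ∀ a ∈ A, k a ∈ A) (hB : ∀ b ∈ B, k b ∈ B) (g : G ≃g G)
    (hgk : ∀ a ∈ A, k a = g a) (S : Finset ℕ) :
    ∃ h : G ≃g G, (∀ x ∈ S, h x = g x) ∧ ∃ e : G ≃g G, (∀ a ∈ A, e a = a) ∧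
      ∀ b ∈ B, e (k b) = h (e b) := by
  classical
  obtain ⟨h0, C, hSC, hC, hh0⟩ := eppa hG g (S ∪ A)
  have hAC : ∀ a ∈ A, a ∈ C := fun a ha => hSC (Finset.mem_union_right _ ha)
  have h0k : ∀ a ∈ A, h0 a = k a := fun a ha => by
    rw [hgk a ha]; exact hh0 a (Finset.mem_union_right _ ha)
  obtain ⟨f, f1, f2, f3, f4⟩ := embed hG (W := {b // b ∈ B \ A}) (G.comap Subtype.val) C
    (fun b c => c ∈ A ∧ G.Adj b c)
  -- make it an automorphism fixing A
  obtain ⟨e, he⟩ := homog' hG (W := {b // b ∈ B \ A} ⊕ {a // a ∈ A})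
    (Sum.elim Subtype.val Subtype.val) (Sum.elim f Subtype.val) (by
      rintro (⟨v, hv⟩ | ⟨v, hv⟩) (⟨w, hw⟩ | ⟨w, hw⟩)
      · simp [f1.eq_iff]
      · simp only [Sum.elim_inl, Sum.elim_inr]
        constructor
        · rintro rfl; exact absurd hw (Finset.mem_sdiff.1 hv).2
        · intro e; exact absurd (e ▸ hAC w hw) (f2 ⟨v, hv⟩)
      · simp only [Sum.elim_inl, Sum.elim_inr]
        constructor
        · rintro rfl; exact absurd hv (Finset.mem_sdiff.1 hw).2
        · intro e; exact absurd (e ▸ hAC v hv) (f2 ⟨w, hw⟩)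
      · simp) (by
      rintro (⟨v, hv⟩ | ⟨v, hv⟩) (⟨w, hw⟩ | ⟨w, hw⟩)
      · simp [f3]
      · simp only [Sum.elim_inl, Sum.elim_inr]
        rw [f4 _ _ (hAC w hw)]; simp [hw]
      · simp only [Sum.elim_inl, Sum.elim_inr]
        rw [G.adj_comm, G.adj_comm v, f4 _ _ (hAC v hv)]; simp [hv]
      · simp)
  have eA : ∀ a ∈ A, e a = a := fun a ha => he (Sum.inr ⟨a, ha⟩)
  have eBC : ∀ b ∈ B, b ∉ A → e b ∉ C := by
    intro b hb hb'
    have := he (Sum.inl ⟨b, Finset.mem_sdiff.2 ⟨hb, hb'⟩⟩)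
    simp only [Sum.elim_inl] at this
    rw [this]; exact f2 _
  have eBa : ∀ b ∈ B, b ∉ A → ∀ c ∈ C, (G.Adj (e b) c ↔ c ∈ A ∧ G.Adj b c) := by
    intro b hb hb' c hc
    have := he (Sum.inl ⟨b, Finset.mem_sdiff.2 ⟨hb, hb'⟩⟩)
    simp only [Sum.elim_inl] at this
    rw [this]; exact f4 _ c hc
  have cross : ∀ c ∈ C, ∀ b ∈ B, (c = e b ↔ h0 c = e (k b)) ∧
      (G.Adj c (e b) ↔ G.Adj (h0 c) (e (k b))) := by
    intro c hc b hb
    by_cases hbA : b ∈ A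
    · rw [eA b hbA, eA _ (hA b hbA), ← h0k b hbA, h0.injective.eq_iff, h0.map_adj_iff]
      simp
    · have hkb : k b ∉ A := fun h => hbA (inv_mem k A hA b h)
      refine ⟨⟨fun h => absurd (h ▸ hc) (eBC b hb hbA),
        fun h => absurd (h ▸ hC c hc) (eBC _ (hB b hb) hkb)⟩, ?_⟩
      rw [G.adj_comm, G.adj_comm (h0 c), eBa b hb hbA c hc, eBa _ (hB b hb) hkb _ (hC c hc)]
      have hcA : h0 c ∈ A ↔ c ∈ A := by
        constructor
        · exact inv_mem h0 A (fun a ha => by rw [h0k a ha]; exact hA a ha) c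
        · intro h; rw [h0k c h]; exact hA c h
      rw [hcA]
      refine and_congr_right fun h => ?_
      rw [h0k c h, k.map_adj_iff]
  obtain ⟨h, hh⟩ := homog' hG (W := {c // c ∈ C} ⊕ {b // b ∈ B})
    (Sum.elim Subtype.val (fun b => e b)) (Sum.elim (fun c => h0 c) (fun b => e (k b))) (by
      rintro (⟨v, hv⟩ | ⟨v, hv⟩) (⟨w, hw⟩ | ⟨w, hw⟩)
      · simp
      · exact (cross v hv w hw).1
      · have := (cross w hw v hv).1
        simp only [Sum.elim_inl, Sum.elim_inr]
        rw [eq_comm, this, eq_comm]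
      · simp) (by
      rintro (⟨v, hv⟩ | ⟨v, hv⟩) (⟨w, hw⟩ | ⟨w, hw⟩)
      · exact h0.map_adj_iff.symm
      · exact (cross v hv w hw).2
      · have := (cross w hw v hv).2
        simp only [Sum.elim_inl, Sum.elim_inr]
        rw [G.adj_comm, this, G.adj_comm]
      · simp only [Sum.elim_inr]
        rw [e.map_adj_iff, e.map_adj_iff, k.map_adj_iff])
  refine ⟨h, fun x hx => ?_, e, eA, fun b hb => (hh (Sum.inr ⟨b, hb⟩)).symm⟩
  have hx' : x ∈ S ∪ A := Finset.mem_union_left _ hx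
  rw [← hh0 x hx']
  exact hh (Sum.inl ⟨x, hSC hx'⟩)

/-- First genericity condition. -/
def GenA {G : SimpleGraph ℕ} (g : G ≃g G) : Prop :=
  ∀ S : Finset ℕ, ∃ C : Finset ℕ, S ⊆ C ∧ ∀ c ∈ C, g c ∈ C

/-- Second genericity condition, for given data. -/
def GenB {G : SimpleGraph ℕ} (A B : Finset ℕ) (k g : G ≃g G) : Prop :=
  (∀ a ∈ A, k a = g a) → ∃ e : G ≃g G, (∀ a ∈ A, e a = a) ∧ ∀ b ∈ B, e (k b) = g (e b)

/-- The generic automorphisms. -/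
def Gen {G : SimpleGraph ℕ} (g : G ≃g G) : Prop :=
  GenA g ∧ ∀ (A B : Finset ℕ) (k : G ≃g G), A ⊆ B → (∀ a ∈ A, k a ∈ A) → (∀ b ∈ B, k b ∈ B) →
    GenB A B k g

/-- The approximations to a conjugating automorphism. -/
def App {G : SimpleGraph ℕ} (g h : G ≃g G) (s : Finset (ℕ × ℕ)) : Prop :=
  ∃ (φ : G ≃g G) (C : Finset ℕ), s = C.image (fun c => (c, φ c)) ∧
    ∀ c ∈ C, g c ∈ C ∧ φ (g c) = h (φ c)

theorem App.swap {G : SimpleGraph ℕ} {g h : G ≃g G} {s : Finset (ℕ × ℕ)} (H : App g h s) :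
    App h g (s.image Prod.swap) := by
  classical
  obtain ⟨φ, C, rfl, hC⟩ := H
  refine ⟨φ.symm, C.image φ, ?_, ?_⟩
  · ext ⟨a, b⟩
    simp only [Finset.mem_image, Prod.mk.injEq, Prod.exists]
    constructor
    · rintro ⟨x, y, ⟨c, hc, rfl, rfl⟩, e⟩
      simp only [Prod.swap_prod_mk, Prod.mk.injEq] at e
      exact ⟨φ c, ⟨c, hc, rfl⟩, e.1, by simp [e.2]⟩
    · rintro ⟨x, ⟨c, hc, rfl⟩, rfl, rfl⟩
      exact ⟨c, φ c, ⟨c, hc, rfl, rfl⟩, by simp⟩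
  · intro c hc
    obtain ⟨x, hx, rfl⟩ := Finset.mem_image.1 hc
    rw [← (hC x hx).2]
    exact ⟨Finset.mem_image_of_mem _ (hC x hx).1, by simp⟩

theorem App.forth {G : SimpleGraph ℕ} {g h : G ≃g G} (hg : Gen g) (hh : Gen h)
    {s : Finset (ℕ × ℕ)} (H : App g h s) (n : ℕ) :
    ∃ t, s ⊆ t ∧ App g h t ∧ ∃ m, (n, m) ∈ t := by
  classical
  obtain ⟨φ, A, rfl, hA⟩ := H
  obtain ⟨C, hAC, hC⟩ := hg.1 (insert n A)
  have hAC' : A ⊆ C := (Finset.subset_insert _ _).trans hAC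
  obtain ⟨e, e1, e2⟩ := hh.2 (A.image φ) (C.image φ) ((φ.symm.trans g).trans φ)
    (Finset.image_subset_image hAC') (by
      intro a ha
      obtain ⟨x, hx, rfl⟩ := Finset.mem_image.1 ha
      simpa using (hA x hx).1) (by
      intro a ha
      obtain ⟨x, hx, rfl⟩ := Finset.mem_image.1 ha
      simpa using hC x hx) (by
      intro a ha
      obtain ⟨x, hx, rfl⟩ := Finset.mem_image.1 ha
      simpa using (hA x hx).2)
  refine ⟨C.image (fun c => (c, e (φ c))), ?_, ⟨φ.trans e, C, rfl, ?_⟩, e (φ n), ?_⟩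
  · intro x hx
    obtain ⟨a, ha, rfl⟩ := Finset.mem_image.1 hx
    exact Finset.mem_image.2 ⟨a, hAC' ha, by rw [e1 _ (Finset.mem_image_of_mem _ ha)]⟩
  · intro c hc
    refine ⟨hC c hc, ?_⟩
    have := e2 (φ c) (Finset.mem_image_of_mem _ hc)
    simpa using this
  · exact Finset.mem_image.2 ⟨n, hAC (Finset.mem_insert_self _ _), rfl⟩

theorem Gen.conj {G : SimpleGraph ℕ} {g h : G ≃g G} (hg : Gen g) (hh : Gen h) :
    IsConj g h := by
  classical
  have inj : ∀ s, App g h s → PIso G s := by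
    rintro s ⟨φ, C, rfl, -⟩ x hx y hy
    obtain ⟨a, ha, rfl⟩ := Finset.mem_image.1 hx
    obtain ⟨b, hb, rfl⟩ := Finset.mem_image.1 hy
    exact ⟨φ.injective.eq_iff.symm, φ.map_adj_iff.symm⟩
  obtain ⟨e, -, he⟩ := back_forth (App g h) (fun s hs x hx y hy => (inj s hs x hx y hy).1)
    (fun s hs n => hs.forth hg hh n) (by
      intro s hs m
      obtain ⟨t, h1, h2, n, hn⟩ := hs.swap.forth hh hg m
      refine ⟨t.image Prod.swap, ?_, h2.swap, n, ?_⟩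
      · intro x hx
        exact Finset.mem_image.2 ⟨x.swap, h1 (Finset.mem_image_of_mem _ hx), by simp⟩
      · exact Finset.mem_image.2 ⟨(m, n), hn, rfl⟩) ∅ ⟨RelIso.refl _, ∅, by simp, by simp⟩
  let E : G ≃g G := ⟨e, by
    intro a b
    obtain ⟨t, ht, ha, hb, -⟩ := he a b
    exact ((inj t ht _ ha _ hb).2).symm⟩
  rw [isConj_iff]
  refine ⟨E, ?_⟩
  rw [mul_inv_eq_iff_eq_mul]
  ext a
  obtain ⟨t, ⟨φ, C, rfl, hC⟩, ha, -, ht⟩ := he a a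
  obtain ⟨c, hc, e1⟩ := Finset.mem_image.1 ha
  obtain ⟨rfl, e2⟩ := Prod.mk.inj e1
  have h1 := ht _ (Finset.mem_image_of_mem (fun c => (c, φ c)) (hC c hc).1)
  simp only at h1
  change e (g c) = h (e c)
  rw [h1, (hC c hc).2, e2]

theorem nhds_iff (G : SimpleGraph ℕ) (g : G ≃g G) (U : Set (G ≃g G)) :
    U ∈ @nhds _ (graphAutPointwiseTopology G) g ↔
      ∃ S : Finset ℕ, ∀ h : G ≃g G, (∀ x ∈ S, h x = g x) → h ∈ U := by
  have : graphAutPointwiseTopology G =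
    TopologicalSpace.induced (fun g : G ≃g G => (g : ℕ → ℕ)) Pi.topologicalSpace := rfl
  rw [this, nhds_induced, Filter.mem_comap]
  constructor
  · rintro ⟨t, ht, htU⟩
    rw [nhds_pi, Filter.mem_pi] at ht
    obtain ⟨I, hI, u, hu, hsub⟩ := ht
    refine ⟨hI.toFinset, fun h hh => htU (hsub ?_)⟩
    intro i hi
    change h i ∈ u i
    rw [hh i (hI.mem_toFinset.2 hi)]
    exact mem_of_mem_nhds (hu i)
  · rintro ⟨S, hS⟩
    refine ⟨(S : Set ℕ).pi (fun x => {g x}), ?_, ?_⟩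
    · exact set_pi_mem_nhds S.finite_toSet (fun i _ => by simp [nhds_discrete])
    · intro h hh
      exact hS h (fun x hx => hh x hx)

theorem mem_residual_of (G : SimpleGraph ℕ) (U : Set (G ≃g G))
    (ho : ∀ g ∈ U, ∃ S : Finset ℕ, ∀ h : G ≃g G, (∀ x ∈ S, h x = g x) → h ∈ U)
    (hd : ∀ (g : G ≃g G) (S : Finset ℕ), ∃ h ∈ U, ∀ x ∈ S, h x = g x) :
    U ∈ @residual _ (graphAutPointwiseTopology G) := by
  letI := graphAutPointwiseTopology G
  apply residual_of_dense_open
  · rw [isOpen_iff_mem_nhds]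
    exact fun g hg => (nhds_iff G g U).2 (ho g hg)
  · intro g
    rw [mem_closure_iff_nhds]
    intro t ht
    obtain ⟨S, hS⟩ := (nhds_iff G g t).1 ht
    obtain ⟨h, hU, hh⟩ := hd g S
    exact ⟨h, hS h hh, hU⟩

theorem gen_residual {G : SimpleGraph ℕ} (hG : G.ExtensionProperty) :
    {g : G ≃g G | Gen g} ∈ @residual _ (graphAutPointwiseTopology G) := by
  classical
  letI := graphAutPointwiseTopology G
  have hA : ∀ᶠ g : G ≃g G in residual _, GenA g := by
    unfold GenA
    rw [eventually_countable_forall]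
    intro S
    apply mem_residual_of
    · rintro g ⟨C, h1, h2⟩
      exact ⟨C, fun h hh => ⟨C, h1, fun c hc => by rw [hh c hc]; exact h2 c hc⟩⟩
    · intro g T
      obtain ⟨h, C, h1, h2, h3⟩ := eppa hG g (S ∪ T)
      exact ⟨h, ⟨C, Finset.subset_union_left.trans h1, h2⟩,
        fun x hx => h3 x (Finset.mem_union_right _ hx)⟩
  have hB : ∀ᶠ g : G ≃g G in residual _, ∀ (p : Finset ℕ × Σ B : Finset ℕ, (B → ℕ)),
      ∀ k : G ≃g G, (∀ b : p.2.1, k b = p.2.2 b) → p.1 ⊆ p.2.1 → (∀ a ∈ p.1, k a ∈ p.1) →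
      (∀ b ∈ p.2.1, k b ∈ p.2.1) → GenB p.1 p.2.1 k g := by
    rw [eventually_countable_forall]
    rintro ⟨A, B, q⟩
    by_cases hk : ∃ k : G ≃g G, (∀ b : B, k b = q b) ∧ A ⊆ B ∧ (∀ a ∈ A, k a ∈ A) ∧
      (∀ b ∈ B, k b ∈ B)
    · obtain ⟨k, k1, k2, k3, k4⟩ := hk
      have : ∀ᶠ g : G ≃g G in residual _, GenB A B k g := by
        apply mem_residual_of
        · intro g hg
          by_cases hgk : ∀ a ∈ A, k a = g a
          · obtain ⟨e, e1, e2⟩ := hg hgk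
            refine ⟨B.image e, fun h hh _ => ⟨e, e1, fun b hb => ?_⟩⟩
            rw [e2 b hb, hh _ (Finset.mem_image_of_mem _ hb)]
          · refine ⟨A, fun h hh hc => absurd (fun a ha => ?_) hgk⟩
            rw [hc a ha, hh a ha]
        · intro g S
          by_cases hgk : ∀ a ∈ A, k a = g a
          · obtain ⟨h, h1, h2⟩ := amalg hG A B k k3 k4 g hgk S
            exact ⟨h, fun _ => h2, h1⟩
          · exact ⟨g, fun h => absurd h hgk, fun _ _ => rfl⟩
      filter_upwards [this] with g hg k' k1' _ _ _ hc
      have kk : ∀ b ∈ B, k' b = k b := fun b hb => by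
        rw [k1' ⟨b, hb⟩, k1 ⟨b, hb⟩]
      obtain ⟨e, e1, e2⟩ := hg (fun a ha => by rw [← kk a (k2 ha)]; exact hc a ha)
      exact ⟨e, e1, fun b hb => by rw [kk b hb]; exact e2 b hb⟩
    · exact Filter.Eventually.of_forall fun g k h1 h2 h3 h4 => absurd ⟨k, h1, h2, h3, h4⟩ hk
  filter_upwards [hA, hB] with g h1 h2
  exact ⟨h1, fun A B k a b c => h2 (A, ⟨B, fun b => k b⟩) k (fun _ => rfl) a b c⟩

theorem baire (G : SimpleGraph ℕ) : @BaireSpace _ (graphAutPointwiseTopology G) := by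
  letI := graphAutPointwiseTopology G
  let ι : (G ≃g G) → (ℕ → ℕ) × (ℕ → ℕ) := fun g => (g, g.symm)
  have hc : Continuous (fun g : G ≃g G => (g : ℕ → ℕ)) := continuous_induced_dom
  have hc' : Continuous (fun g : G ≃g G => (g.symm : ℕ → ℕ)) := by
    rw [continuous_pi_iff]
    intro n
    rw [continuous_iff_continuousAt]
    intro g
    unfold ContinuousAt
    rw [nhds_discrete ℕ, Filter.tendsto_pure]
    apply (nhds_iff G g _).2
    refine ⟨{g.symm n}, fun h hh => ?_⟩
    have := hh _ (Finset.mem_singleton_self _)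
    simp only [RelIso.apply_symm_apply] at this
    change h.symm n = g.symm n
    exact h.injective (by rw [this, h.apply_symm_apply])
  have hι : IsClosedEmbedding ι := by
    refine ⟨⟨⟨?_⟩, ?_⟩, ?_⟩
    · apply le_antisymm
      · exact (hc.prodMk hc').le_induced
      · have : Continuous (Prod.fst : (ℕ → ℕ) × (ℕ → ℕ) → (ℕ → ℕ)) := continuous_fst
        letI t2 := TopologicalSpace.induced ι inferInstance
        exact (this.comp continuous_induced_dom).le_induced
    · intro g h e
      exact DFunLike.coe_injective (congrArg Prod.fst e)
    · have : Set.range ι = {p | (∀ n, p.1 (p.2 n) = n) ∧ (∀ n, p.2 (p.1 n) = n) ∧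
          ∀ a b, (G.Adj (p.1 a) (p.1 b) ↔ G.Adj a b)} := by
        ext ⟨p, q⟩
        constructor
        · rintro ⟨g, e⟩
          obtain ⟨rfl, rfl⟩ := Prod.mk.inj e
          exact ⟨fun n => g.apply_symm_apply n, fun n => g.symm_apply_apply n,
            fun a b => g.map_adj_iff⟩
        · rintro ⟨h1, h2, h3⟩
          exact ⟨⟨⟨p, q, h2, h1⟩, fun {a b} => h3 a b⟩, rfl⟩
      rw [this]
      have ev : ∀ n, Continuous (fun p : (ℕ → ℕ) × (ℕ → ℕ) => p.1 n) := by
        intro n; fun_prop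
      have ev' : ∀ n, Continuous (fun p : (ℕ → ℕ) × (ℕ → ℕ) => p.2 n) := by
        intro n; fun_prop
      have app : Continuous (fun x : (ℕ → ℕ) × ℕ => x.1 x.2) := by
        rw [continuous_prod_of_discrete_right]
        intro n
        fun_prop
      simp only [Set.ofPred_and, Set.ofPred_forall]
      refine IsClosed.inter (isClosed_iInter fun n => ?_)
        (IsClosed.inter (isClosed_iInter fun n => ?_)
          (isClosed_iInter fun a => isClosed_iInter fun b => ?_))
      · exact isClosed_eq (app.comp (continuous_fst.prodMk (ev' n))) continuous_const
      · exact isClosed_eq (app.comp (continuous_snd.prodMk (ev n))) continuous_const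
      · exact (isClosed_discrete {x : ℕ × ℕ | G.Adj x.1 x.2 ↔ G.Adj a b}).preimage
          ((ev a).prodMk (ev b))
  haveI : PolishSpace (G ≃g G) := hι.polishSpace
  infer_instance

end RadoGeneric

/-- The random graph has a generic automorphism: an element of `Aut(G)` whose conjugacy
class is comeagre in the topology of pointwise convergence. -/
theorem exists_generic_automorphism_randomGraph (G : SimpleGraph ℕ)
    (hG : G.ExtensionProperty) :
    ∃ g : G ≃g G,
      {h : G ≃g G | IsConj g h} ∈ @residual (G ≃g G) (graphAutPointwiseTopology G) := by
  letI := graphAutPointwiseTopology G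
  haveI := RadoGeneric.baire G
  have hr := RadoGeneric.gen_residual hG
  obtain ⟨g, hg⟩ := (dense_of_mem_residual hr).nonempty_iff.2 ⟨RelIso.refl _⟩
  exact ⟨g, Filter.mem_of_superset hr fun h hh => RadoGeneric.Gen.conj hg hh⟩
end

section
/- The absolute Galois group Gal(ℚ̄/ℚ), i.e. the group of ℚ-algebra automorphisms of the algebraic closure of ℚ, has a subgroup of finite index that is not open in the Krull topology. -/
namespace NonOpenSubgroup

/-- The algebraic closure of the rationals. -/
abbrev QB := AlgebraicClosure ℚ

/-- The absolute Galois group. -/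
abbrev GQ := QB ≃ₐ[ℚ] QB

instance instIsAlgebraicQB : Algebra.IsAlgebraic ℚ QB := by
  have h := AlgebraicClosure.isAlgebraic ℚ
  have e : (DivisionRing.toRatAlgebra : Algebra ℚ QB) = AlgebraicClosure.instAlgebra ℚ :=
    Subsingleton.elim _ _
  rw [e]
  exact h

instance instIsAlgClosureQB : IsAlgClosure ℚ QB := ⟨inferInstance, inferInstance⟩

instance instIsGaloisQB : IsGalois ℚ QB := IsAlgClosure.isGalois ℚ QB

theorem exists_root (p : Nat.Primes) : ∃ r : QB, r ^ 2 = ((p : ℕ) : QB) :=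
  IsAlgClosed.exists_pow_nat_eq _ (by norm_num)

/-- A chosen square root of the prime `p`. -/
noncomputable def rt (p : Nat.Primes) : QB := (exists_root p).choose

theorem rt_sq (p : Nat.Primes) : rt p ^ 2 = ((p : ℕ) : QB) := (exists_root p).choose_spec

theorem rt_ne (p : Nat.Primes) : rt p ≠ 0 := by
  intro h
  have h1 := rt_sq p
  rw [h] at h1
  have h2 : ((p : ℕ) : QB) ≠ 0 := Nat.cast_ne_zero.mpr p.2.ne_zero
  exact h2 (by rw [← h1]; norm_num)

theorem map_rt (σ : GQ) (p : Nat.Primes) : σ (rt p) = rt p ∨ σ (rt p) = -rt p := by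
  apply sq_eq_sq_iff_eq_or_eq_neg.mp
  rw [← map_pow, rt_sq, map_natCast]

/-- The sign attached to an element of `ZMod 2`. -/
noncomputable def sg (a : ZMod 2) : QB := if a = 0 then 1 else -1

theorem sg_add (a b : ZMod 2) : sg (a + b) = sg a * sg b := by
  have h : ∀ x : ZMod 2, x = 0 ∨ x = 1 := by decide
  have h2 : (1 : ZMod 2) + 1 = 0 := by decide
  rcases h a with rfl | rfl <;> rcases h b with rfl | rfl <;> simp [sg, h2]

theorem sg_inj {a b : ZMod 2} (hab : sg a = sg b) : a = b := by
  have h : ∀ x : ZMod 2, x = 0 ∨ x = 1 := by decide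
  have h3 : (1 : QB) ≠ -1 := by norm_num
  rcases h a with rfl | rfl <;> rcases h b with rfl | rfl <;> simp [sg] at hab ⊢
  · exact h3 hab
  · exact h3 hab.symm

open Classical in
/-- The quadratic character of the prime `p`. -/
noncomputable def chi (p : Nat.Primes) (σ : GQ) : ZMod 2 := if σ (rt p) = rt p then 0 else 1

theorem chi_spec (p : Nat.Primes) (σ : GQ) : σ (rt p) = sg (chi p σ) * rt p := by
  unfold chi
  split_ifs with h
  · simp [sg, h]
  · simp [sg, (map_rt σ p).resolve_left h]

theorem sg_map (σ : GQ) (a : ZMod 2) : σ (sg a) = sg a := by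
  unfold sg; split_ifs <;> simp

theorem chi_mul (p : Nat.Primes) (σ τ : GQ) : chi p (σ * τ) = chi p σ + chi p τ := by
  apply sg_inj
  apply mul_right_cancel₀ (rt_ne p)
  rw [← chi_spec, AlgEquiv.mul_apply, chi_spec p τ, map_mul, sg_map, chi_spec p σ, sg_add]
  ring

/-- All the quadratic characters together. -/
noncomputable def phi : GQ →* Multiplicative (Nat.Primes → ZMod 2) :=
  MonoidHom.mk' (fun σ => Multiplicative.ofAdd (fun p => chi p σ)) (by
    intro σ τ
    rw [← ofAdd_add]
    congr 1
    funext p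
    exact chi_mul p σ τ)

theorem map_prod_rt (σ : GQ) (T : Finset Nat.Primes) :
    σ (∏ p ∈ T, rt p) = sg (∑ p ∈ T, chi p σ) * ∏ p ∈ T, rt p := by
  classical
  induction T using Finset.induction_on with
  | empty => simp [sg]
  | insert a s ha ih =>
    rw [Finset.prod_insert ha, Finset.sum_insert ha, map_mul, ih, chi_spec, sg_add]
    ring

theorem not_square (T : Finset Nat.Primes) (p : Nat.Primes) (hp : p ∈ T) (q : ℚ)
    (h : q ^ 2 = ((∏ p ∈ T, (p : ℕ) : ℕ) : ℚ)) : False := by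
  classical
  have h1 : IsSquare ((∏ p ∈ T, (p : ℕ) : ℕ) : ℚ) := ⟨q, by rw [← h, sq]⟩
  rw [Rat.isSquare_natCast_iff] at h1
  obtain ⟨m, hm⟩ := h1
  have hd : (p : ℕ) ∣ m * m := hm ▸ Finset.dvd_prod_of_mem (fun p : Nat.Primes => (p : ℕ)) hp
  have hd2 : (p : ℕ) ∣ m := by simpa using (p.2.dvd_mul.mp hd)
  have hd3 : (p : ℕ) * p ∣ ∏ p ∈ T, (p : ℕ) := hm ▸ mul_dvd_mul hd2 hd2
  rw [← Finset.mul_prod_erase T _ hp] at hd3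
  have hd4 := Nat.dvd_of_mul_dvd_mul_left p.2.pos hd3
  obtain ⟨r, hr, hr2⟩ := (Prime.dvd_finsetProd_iff p.2.prime _).mp hd4
  have := (Nat.prime_dvd_prime_iff_eq p.2 r.2).mp hr2
  exact (Finset.ne_of_mem_erase hr) (Subtype.ext this.symm)

theorem exists_moved (T : Finset Nat.Primes) (p : Nat.Primes) (hp : p ∈ T) :
    ∃ σ : GQ, ∑ p ∈ T, chi p σ ≠ 0 := by
  by_contra! hcon
  have hfix : ∀ σ : GQ, σ (∏ p ∈ T, rt p) = ∏ p ∈ T, rt p := by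
    intro σ
    rw [map_prod_rt, hcon σ]; simp [sg]
  have := (InfiniteGalois.mem_bot_iff_fixed (k := ℚ) (∏ p ∈ T, rt p)).mpr hfix
  obtain ⟨q, hq⟩ := IntermediateField.mem_bot.mp this
  apply not_square T p hp q
  apply (algebraMap ℚ QB).injective
  rw [map_pow, hq, ← Finset.prod_pow]
  simp [rt_sq]

theorem finite_surj (F : Finset Nat.Primes) (y : F → ZMod 2) :
    ∃ σ : GQ, ∀ p : F, chi p σ = y p := by
  classical
  let f : GQ →* Multiplicative (F → ZMod 2) :=
    MonoidHom.mk' (fun σ => Multiplicative.ofAdd (fun p => chi p σ)) (by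
      intro σ τ
      rw [← ofAdd_add]
      congr 1
      funext p
      exact chi_mul p σ τ)
  let W0 : AddSubgroup (F → ZMod 2) := Subgroup.toAddSubgroup' f.range
  let W : Submodule (ZMod 2) (F → ZMod 2) := AddSubgroup.toZModSubmodule 2 W0
  have hmem : ∀ σ : GQ, (fun p : F => chi p σ) ∈ W := fun σ => ⟨σ, rfl⟩
  have hW : W = ⊤ := by
    by_contra hne
    obtain ⟨g, hg0, hg⟩ := Submodule.exists_le_ker_of_lt_top W (lt_top_iff_ne_top.mpr hne)
    have hsum : ∀ x : F → ZMod 2, g x = ∑ p, x p * g (Pi.single p 1) := by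
      intro x
      conv_lhs => rw [pi_eq_sum_univ' x]
      rw [map_sum]
      refine Finset.sum_congr rfl fun p _ => ?_
      rw [map_smul, smul_eq_mul]
    have h01 : ∀ x : ZMod 2, x ≠ 0 → x = 1 := by decide
    let T : Finset F := Finset.univ.filter fun p => g (Pi.single p 1) ≠ 0
    have hT : ∀ x : F → ZMod 2, g x = ∑ p ∈ T, x p := by
      intro x
      rw [hsum, Finset.sum_filter]
      refine Finset.sum_congr rfl fun p _ => ?_
      split_ifs with h
      · rw [h01 _ h, mul_one]
      · rw [not_not.mp h, mul_zero]
    have hTne : T.Nonempty := by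
      by_contra hempty
      rw [Finset.not_nonempty_iff_eq_empty] at hempty
      apply hg0
      ext x
      simp [hT, hempty]
    obtain ⟨p, hp⟩ := hTne
    obtain ⟨σ, hσ⟩ := exists_moved (T.map (Function.Embedding.subtype _)) p
      (Finset.mem_map.mpr ⟨p, hp, rfl⟩)
    apply hσ
    rw [Finset.sum_map]
    have := LinearMap.mem_ker.mp (hg (hmem σ))
    rw [hT] at this
    exact this
  have hy : y ∈ W := hW ▸ Submodule.mem_top
  obtain ⟨σ, hσ⟩ := hy
  exact ⟨σ, fun p => congrFun hσ p⟩

theorem isOpen_stab (p : Nat.Primes) : IsOpen {σ : GQ | σ (rt p) = rt p} := by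
  have hfd : FiniteDimensional ℚ (IntermediateField.adjoin ℚ {rt p}) :=
    IntermediateField.adjoin.finiteDimensional (Algebra.IsIntegral.isIntegral (rt p))
  have h := IntermediateField.fixingSubgroup_isOpen (IntermediateField.adjoin ℚ {rt p})
  have hle : (IntermediateField.adjoin ℚ {rt p}).fixingSubgroup ≤
      MulAction.stabilizer GQ (rt p) := by
    intro σ hσ
    rw [IntermediateField.mem_fixingSubgroup_iff] at hσ
    exact hσ _ (IntermediateField.mem_adjoin_simple_self ℚ (rt p))
  exact Subgroup.isOpen_mono hle h

theorem chi_cont (p : Nat.Primes) : Continuous (chi p) := by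
  have h := isOpen_stab p
  have hc : IsClopen {σ : GQ | σ (rt p) = rt p} :=
    ⟨Subgroup.isClosed_of_isOpen (MulAction.stabilizer GQ (rt p)) h, h⟩
  classical
  apply IsLocallyConstant.continuous
  have := (IsLocallyConstant.iff_continuous (chi p)).mpr ?_
  · exact this
  · unfold chi
    refine continuous_if ?_ continuousOn_const continuousOn_const
    intro a ha
    rw [hc.frontier_eq] at ha
    exact ha.elim

/-- All the characters together, as a plain map. -/
noncomputable def psi (σ : GQ) : Nat.Primes → ZMod 2 := fun p => chi p σ

theorem psi_cont : Continuous psi := continuous_pi chi_cont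

theorem psi_surj : Function.Surjective psi := by
  have hcl : IsClosed (Set.range psi) := (isCompact_range psi_cont).isClosed
  intro y
  change y ∈ Set.range psi
  rw [← hcl.closure_eq, mem_closure_iff_nhds]
  intro t ht
  rw [nhds_pi, Filter.mem_pi] at ht
  obtain ⟨I, hI, u, hu, hsub⟩ := ht
  obtain ⟨σ, hσ⟩ := finite_surj hI.toFinset (fun p => y p)
  refine ⟨psi σ, hsub ?_, σ, rfl⟩
  intro p hp
  have : psi σ p = y p := hσ ⟨p, hI.mem_toFinset.mpr hp⟩
  rw [this]
  exact mem_of_mem_nhds (hu p)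

theorem exists_functional : ∃ g : (Nat.Primes → ZMod 2) →ₗ[ZMod 2] ZMod 2, g ≠ 0 ∧
    ∀ x : Nat.Primes → ZMod 2, {p | x p ≠ 0}.Finite → g x = 0 := by
  let D : Submodule (ZMod 2) (Nat.Primes → ZMod 2) :=
    { carrier := {x | {p | x p ≠ 0}.Finite}
      zero_mem' := by simp
      add_mem' := by
        intro a b ha hb
        refine (Set.Finite.union ha hb).subset ?_
        intro p hp
        by_contra hcon
        simp only [Set.mem_union, Set.mem_ofPred_eq, not_or, not_not] at hcon
        exact hp (by simp [hcon.1, hcon.2])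
      smul_mem' := by
        intro c x hx
        refine Set.Finite.subset hx ?_
        intro p hp hcon
        exact hp (by simp [hcon]) }
  have hD : D < ⊤ := by
    rw [lt_top_iff_ne_top]
    intro h
    have h1 : (fun _ => 1 : Nat.Primes → ZMod 2) ∈ D := h ▸ Submodule.mem_top
    have h2 : {p : Nat.Primes | (1 : ZMod 2) ≠ 0}.Finite := h1
    simp only [ne_eq, one_ne_zero, not_false_eq_true, Set.ofPred_true] at h2
    exact Set.infinite_univ h2
  obtain ⟨g, hg0, hg⟩ := Submodule.exists_le_ker_of_lt_top D hD
  exact ⟨g, hg0, fun x hx => hg hx⟩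

end NonOpenSubgroup

/-- The absolute Galois group `Gal(ℚ̄/ℚ)` has a subgroup of finite index which is not
open in the Krull topology. -/
theorem exists_finiteIndex_subgroup_not_isOpen_absoluteGaloisGroup :
    ∃ H : Subgroup (AlgebraicClosure ℚ ≃ₐ[ℚ] AlgebraicClosure ℚ),
      H.FiniteIndex ∧ ¬IsOpen (H : Set (AlgebraicClosure ℚ ≃ₐ[ℚ] AlgebraicClosure ℚ)) := by
  classical
  obtain ⟨g, hg0, hg⟩ := NonOpenSubgroup.exists_functional
  let F : NonOpenSubgroup.GQ →* Multiplicative (ZMod 2) :=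
    (AddMonoidHom.toMultiplicative g.toAddMonoidHom).comp NonOpenSubgroup.phi
  have : Finite (Multiplicative (ZMod 2)) := inferInstanceAs (Finite (ZMod 2))
  refine ⟨F.ker, inferInstance, fun hopen => hg0 ?_⟩
  have hq : Topology.IsQuotientMap NonOpenSubgroup.psi :=
    NonOpenSubgroup.psi_cont.isClosedMap.isQuotientMap
      NonOpenSubgroup.psi_cont NonOpenSubgroup.psi_surj
  have hk : IsOpen {x : Nat.Primes → ZMod 2 | g x = 0} := hq.isOpen_preimage.mp hopen
  have hn := hk.mem_nhds (show (0 : Nat.Primes → ZMod 2) ∈ {x | g x = 0} from map_zero g)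
  rw [nhds_pi, Filter.mem_pi] at hn
  obtain ⟨I, hI, u, hu, hsub⟩ := hn
  ext1 x
  have hx : x = (fun p => if p ∈ I then x p else 0) + (fun p => if p ∈ I then 0 else x p) := by
    funext p
    by_cases h : p ∈ I <;> simp [h]
  have h1 : g (fun p => if p ∈ I then x p else 0) = 0 := by
    apply hg
    refine hI.subset ?_
    intro p hp
    by_contra hcon
    exact hp (by simp [hcon])
  have h2 : g (fun p => if p ∈ I then 0 else x p) = 0 := by
    apply hsub
    intro p hp
    simp only [hp, if_true]
    exact mem_of_mem_nhds (hu p)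
  rw [hx, map_add, h1, h2]
  simp
end

section
/- Let K be a countable algebraically closed field of characteristic 0 whose transcendence degree over ℚ is infinite (i.e. there exists an infinite family of elements of K that is algebraically independent over ℚ). Then the automorphism group Aut(K) fails the small index property: there exists a subgroup H of Aut(K) of finite index such that for every finite set A ⊆ K, the pointwise stabilizer of A is not contained in H. -/
open IntermediateField in
/-- Elements of a simple quadratic extension have the form `a + b x`. -/
theorem sipf_quad {k L : Type*} [Field k] [Field L] [Algebra k L] {x y : L} {c : k}
    (hx : x ^ 2 = algebraMap k L c) (hy : y ∈ k⟮x⟯) :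
    ∃ a b : k, y = algebraMap k L a + algebraMap k L b * x := by
  have halg : IsAlgebraic k x := by
    refine IsIntegral.isAlgebraic ⟨Polynomial.X ^ 2 - Polynomial.C c,
      Polynomial.monic_X_pow_sub_C c two_ne_zero, ?_⟩
    simp [hx]
  have hy' : y ∈ Algebra.adjoin k {x} := by
    rw [← adjoin_simple_toSubalgebra_of_isAlgebraic halg]
    exact hy
  induction hy' using Algebra.adjoin_induction with
  | mem z hz =>
    rw [Set.mem_singleton_iff] at hz
    exact ⟨0, 1, by simp [hz]⟩
  | algebraMap r => exact ⟨r, 0, by simp⟩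
  | add u v hu hv ihu ihv =>
    have mm : ∀ w ∈ Algebra.adjoin k {x}, w ∈ k⟮x⟯ := fun w hw =>
      algebra_adjoin_le_adjoin k {x} hw
    obtain ⟨a, b, h1⟩ := ihu (mm u hu)
    obtain ⟨a', b', h2⟩ := ihv (mm v hv)
    refine ⟨a + a', b + b', ?_⟩
    rw [h1, h2, map_add, map_add]
    ring
  | mul u v hu hv ihu ihv =>
    have mm : ∀ w ∈ Algebra.adjoin k {x}, w ∈ k⟮x⟯ := fun w hw =>
      algebra_adjoin_le_adjoin k {x} hw
    obtain ⟨a, b, h1⟩ := ihu (mm u hu)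
    obtain ⟨a', b', h2⟩ := ihv (mm v hv)
    refine ⟨a * a' + b * b' * c, a * b' + a' * b, ?_⟩
    rw [h1, h2]
    simp only [map_add, map_mul, ← hx]
    ring

open IntermediateField in
/-- If `x, y` are square roots of elements of `k` and `y ∈ k(x)`, then `y ∈ k` or `y ∈ k x`. -/
theorem sipf_quad' {k L : Type*} [Field k] [Field L] [CharZero L] [Algebra k L] {x y : L} {c d : k}
    (hx : x ^ 2 = algebraMap k L c) (hyd : y ^ 2 = algebraMap k L d) (hy : y ∈ k⟮x⟯) :
    (∃ a : k, y = algebraMap k L a) ∨ ∃ b : k, y = algebraMap k L b * x := by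
  obtain ⟨a, b, h⟩ := sipf_quad hx hy
  by_cases ha : a = 0
  · right
    exact ⟨b, by simp [h, ha]⟩
  by_cases hb : b = 0
  · left
    exact ⟨a, by simp [h, hb]⟩
  left
  have ha' : algebraMap k L a ≠ 0 := by simpa using ha
  have hb' : algebraMap k L b ≠ 0 := by simpa using hb
  have key : algebraMap k L d = algebraMap k L a ^ 2 + algebraMap k L b ^ 2 * algebraMap k L c
      + 2 * algebraMap k L a * algebraMap k L b * x := by
    rw [← hyd, ← hx, h]; ring
  refine ⟨a + (d - a ^ 2 - b ^ 2 * c) / (2 * a), ?_⟩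
  rw [h]
  simp only [map_add, map_sub, map_mul, map_pow, map_div₀, map_ofNat]
  field_simp
  rw [key]; ring

open IntermediateField in
/-- The Galois-theoretic lemma. -/
theorem sipf_galois {k K : Type*} [Field k] [Field K] [CharZero K] [Algebra k K] [IsGalois k K]
    (F : IntermediateField k K) (O : Set K) (x0 : K) (hx0 : x0 ∈ O)
    (h3 : ∀ x ∈ O, ∀ y ∈ O, ∀ z ∈ O, x * y * z ∈ O)
    (hsq : ∀ x ∈ O, ∃ c : k, x ^ 2 = algebraMap k K c)
    (hdis : ∀ x ∈ O, x ∉ F) :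
    ∃ g : K ≃ₐ[k] K, (∀ x ∈ F, g x = x) ∧ ∀ x ∈ O, g x = - x := by
  obtain ⟨E, hFE, hE⟩ := zorn_le_nonempty₀ {E : IntermediateField k K | ∀ x ∈ O, x ∉ E}
    (by
      intro c hc hch y hy
      refine ⟨sSup c, ?_, fun z hz => le_sSup hz⟩
      intro x hx hxs
      have : Nonempty c := ⟨⟨y, hy⟩⟩
      rw [sSup_eq_iSup', ← SetLike.mem_coe, coe_iSup_of_directed hch.directedOn.directed_val,
        Set.mem_iUnion] at hxs
      obtain ⟨i, hi⟩ := hxs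
      exact hc i.2 x hx hi) F hdis
  have hEd : ∀ x ∈ O, x ∉ E := hE.prop
  have hEsq : ∀ x ∈ O, ∃ c : E, x ^ 2 = algebraMap E K c := fun x hx => by
    obtain ⟨c, hc⟩ := hsq x hx
    exact ⟨algebraMap k E c, by rw [hc, ← IsScalarTower.algebraMap_apply]⟩
  have hne : ∀ x ∈ O, x ≠ 0 := fun x hx h => hEd x hx (h ▸ E.zero_mem)
  have claim : ∀ y ∈ O, x0 * y ∈ E := by
    intro y hy
    by_contra hxy
    set E' : IntermediateField k K := (E⟮x0 * y⟯).restrictScalars k with hE'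
    have hle : E ≤ E' := fun z hz => (E⟮x0 * y⟯).algebraMap_mem ⟨z, hz⟩
    have hmem : x0 * y ∈ E' := mem_adjoin_simple_self E (x0 * y)
    have hnot : ¬ ∀ x ∈ O, x ∉ E' := fun h => hxy (hE.le_of_ge h hle hmem)
    push Not at hnot
    obtain ⟨m, hm, hmE⟩ := hnot
    obtain ⟨c0, h0⟩ := hEsq x0 hx0
    obtain ⟨c1, h1⟩ := hEsq y hy
    obtain ⟨d, hd⟩ := hEsq m hm
    have hxysq : (x0 * y) ^ 2 = algebraMap E K (c0 * c1) := by
      rw [mul_pow, h0, h1, map_mul]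
    rcases sipf_quad' hxysq hd hmE with ⟨a, ha⟩ | ⟨b, hb⟩
    · exact hEd m hm (ha ▸ a.2)
    · refine hEd _ (h3 m hm x0 hx0 y hy) ?_
      have : m * x0 * y = algebraMap E K (b * (c0 * c1)) := by
        rw [map_mul, ← hxysq, hb]; ring
      rw [this]
      exact (b * (c0 * c1)).2
  have hx0E : ¬ ∀ f : K ≃ₐ[E] K, f x0 = x0 := by
    rw [← InfiniteGalois.mem_bot_iff_fixed, mem_bot]
    rintro ⟨e, he⟩
    exact hEd x0 hx0 (he ▸ e.2)
  push Not at hx0E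
  obtain ⟨f, hf⟩ := hx0E
  have hfx0 : f x0 = - x0 := by
    obtain ⟨c0, h0⟩ := hEsq x0 hx0
    have : (f x0) ^ 2 = x0 ^ 2 := by rw [← map_pow, h0, f.commutes]
    exact (sq_eq_sq_iff_eq_or_eq_neg.1 this).resolve_left hf
  refine ⟨f.restrictScalars k, fun x hx => f.commutes ⟨x, hFE hx⟩, fun y hy => ?_⟩
  have h := f.commutes ⟨x0 * y, claim y hy⟩
  change f (x0 * y) = x0 * y at h
  rw [map_mul, hfx0] at h
  change f y = - y
  apply mul_left_cancel₀ (hne x0 hx0)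
  linear_combination - h

open IntermediateField in
/-- Pigeonhole on the finitely many quadratic subextensions. -/
theorem sipf_pigeon {k L : Type*} [Field k] [Field L] [CharZero k] [CharZero L] [Algebra k L]
    [FiniteDimensional k L] (x : ℕ → L) (n : ℕ → ℕ) (hx : ∀ i, x i ^ 2 = n i)
    (hk : ∀ i, ∀ a : k, x i ≠ algebraMap k L a) :
    ∃ i j, n i < j ∧ ∃ c : k, c ^ 2 = n i * n j := by
  have hfin : Finite (IntermediateField k L) :=
    Field.finite_intermediateField_of_exists_primitive_element k L
      (Field.exists_primitive_element k L)
  obtain ⟨E, hE⟩ := Finite.exists_infinite_fiber (fun i => k⟮x i⟯)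
  have hE' : ((fun i => k⟮x i⟯) ⁻¹' {E}).Infinite := Set.infinite_coe_iff.1 hE
  obtain ⟨i, hi⟩ := hE'.nonempty
  obtain ⟨j, hj, hij⟩ := hE'.exists_gt (n i)
  have hi : k⟮x i⟯ = E := hi
  have hj : k⟮x j⟯ = E := hj
  refine ⟨i, j, hij, ?_⟩
  have hmem : x j ∈ k⟮x i⟯ := by
    rw [hi, ← hj]; exact mem_adjoin_simple_self k (x j)
  have e : ∀ i, x i ^ 2 = algebraMap k L (n i) := fun i => by rw [hx, map_natCast]
  rcases sipf_quad' (e i) (e j) hmem with ⟨a, ha⟩ | ⟨b, hb⟩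
  · exact absurd ha (hk j a)
  · refine ⟨b * n i, (algebraMap k L).injective ?_⟩
    have h2 := hx j
    rw [hb, mul_pow, hx i] at h2
    simp only [map_pow, map_mul, map_natCast]
    rw [← h2]; ring

open IntermediateField in
/-- A natural number which is a square in a purely transcendental extension is a square. -/
theorem sipf_square {K ι : Type*} [Field K] [CharZero K] (v : ι → K)
    (hv : AlgebraicIndependent ℚ v) (n : ℕ) (x : K) (hx : x ∈ adjoin ℚ (Set.range v))
    (hxn : x ^ 2 = n) : IsSquare n := by
  by_cases hn : n = 0
  · simp [hn]
  have hx0 : x ≠ 0 := by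
    rintro rfl
    simp at hxn
    exact hn (by exact_mod_cast hxn.symm)
  obtain ⟨r, hr, s, hs, hrs⟩ := mem_adjoin_iff_div.1 hx
  rw [Algebra.adjoin_range_eq_range_aeval] at hr hs
  obtain ⟨p, rfl⟩ := hr
  obtain ⟨q, rfl⟩ := hs
  have hq0 : MvPolynomial.aeval v q ≠ 0 := by
    intro h
    change x = MvPolynomial.aeval v p / MvPolynomial.aeval v q at hrs
    rw [h, div_zero] at hrs
    exact hx0 hrs
  have hq : q ≠ 0 := by rintro rfl; simp at hq0
  have hpq : p ^ 2 = q ^ 2 * MvPolynomial.C (n : ℚ) := by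
    apply hv
    change x = MvPolynomial.aeval v p / MvPolynomial.aeval v q at hrs
    rw [hrs] at hxn
    field_simp at hxn
    simp [hxn]
  have hdvd : q ∣ p := (IsIntegrallyClosed.pow_dvd_pow_iff two_ne_zero).1 ⟨_, hpq⟩
  obtain ⟨f, rfl⟩ := hdvd
  rw [mul_pow] at hpq
  have hf : f ^ 2 = MvPolynomial.C (n : ℚ) := mul_left_cancel₀ (pow_ne_zero 2 hq) hpq
  have hu : IsUnit f := by
    apply isUnit_of_dvd_unit (Dvd.intro_left _ (by rw [← hf, sq]) : f ∣ MvPolynomial.C (n : ℚ))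
    rw [MvPolynomial.isUnit_iff_eq_C_of_isReduced]
    exact ⟨n, by simpa using hn, rfl⟩
  obtain ⟨a, -, rfl⟩ := MvPolynomial.isUnit_iff_eq_C_of_isReduced.1 hu
  rw [← MvPolynomial.C_pow] at hf
  have := MvPolynomial.C_injective _ _ hf
  rw [← Rat.isSquare_natCast_iff]
  exact ⟨a, by rw [← this, sq]⟩

open ArithmeticFunction in
theorem sipf_not_square (n : ℕ) (hn : n ≠ 0) (h : Odd (cardFactors n)) : ¬ IsSquare n := by
  rintro ⟨a, rfl⟩
  have ha : a ≠ 0 := by rintro rfl; simp at hn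
  rw [cardFactors_mul ha ha] at h
  exact (Nat.not_odd_iff_even.2 ⟨_, rfl⟩) h

open IntermediateField ArithmeticFunction in
/-- For every finite set there is an automorphism fixing it and negating almost all `√p`. -/
theorem sipf_aut (K : Type*) [Field K] [IsAlgClosed K] [CharZero K] (A : Set K) (hA : A.Finite) :
    ∃ g : K ≃+* K, (∀ a ∈ A, g a = a) ∧
      ∃ N : ℕ, ∀ p : ℕ, p.Prime → N ≤ p → ∀ x : K, x ^ 2 = p → g x = - x := by
  obtain ⟨B, hB⟩ := exists_isTranscendenceBasis ℚ K
  let k := adjoin ℚ (Set.range ((↑) : B → K))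
  have halg : Algebra.IsAlgebraic k K := hB.isAlgebraic_field
  have hcl : IsAlgClosure k K := ⟨inferInstance, halg⟩
  have hnorm : Normal k K := IsAlgClosure.normal k K
  have hgal : IsGalois k K := IsGalois.mk
  let F : IntermediateField k K := adjoin k A
  have : Finite A := hA
  have hfd : FiniteDimensional k F := finiteDimensional_adjoin
    (fun x _ => Algebra.IsIntegral.isIntegral x)
  let O : ℕ → Set K := fun N => {x | ∃ n : ℕ, n ≠ 0 ∧ Odd (cardFactors n) ∧
    (∀ p : ℕ, p.Prime → p ∣ n → N ≤ p) ∧ x ^ 2 = n}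
  have hN : ∃ N, ∀ x ∈ O N, x ∉ F := by
    by_contra hcon
    push Not at hcon
    choose x hxO hxF using hcon
    choose n hn0 hodd hp hxn using hxO
    obtain ⟨i, j, hij, c, hc⟩ := sipf_pigeon (k := k) (L := F) (fun i => ⟨x i, hxF i⟩) n
      (fun i => Subtype.ext (by simpa using hxn i))
      (fun i a ha => sipf_not_square _ (hn0 i) (hodd i)
        (sipf_square _ hB.1 (n i) (x i) (by
          have := congrArg Subtype.val ha
          change x i = (a : K) at this
          rw [this]
          exact a.2) (hxn i)))
    have hsq : IsSquare (n i * n j) := sipf_square _ hB.1 _ (c : K) c.2 (by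
      have := congrArg Subtype.val hc
      push_cast
      simpa using this)
    have hcop : Nat.Coprime (n i) (n j) := by
      rw [Nat.coprime_iff_gcd_eq_one]
      by_contra h
      obtain ⟨p, hpp, hpd⟩ := Nat.exists_prime_and_dvd h
      have h1 := Nat.le_of_dvd (Nat.pos_of_ne_zero (hn0 i)) (hpd.trans (Nat.gcd_dvd_left _ _))
      have h2 := hp j p hpp (hpd.trans (Nat.gcd_dvd_right _ _))
      omega
    obtain ⟨m, hm⟩ := hsq
    rw [← sq] at hm
    obtain ⟨d, hd⟩ := exists_eq_pow_of_mul_eq_pow (by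
      rw [Nat.isUnit_iff]; exact hcop) hm
    exact sipf_not_square _ (hn0 i) (hodd i) ⟨d, by rw [hd, sq]⟩
  obtain ⟨N, hN⟩ := hN
  have hprime : ∀ p : ℕ, p.Prime → N ≤ p → ∀ x : K, x ^ 2 = p → x ∈ O N := by
    intro p hp hNp x hx
    refine ⟨p, hp.ne_zero, ?_, ?_, hx⟩
    · rw [cardFactors_apply_prime hp]; exact odd_one
    · intro q hq hqp
      rwa [(Nat.prime_dvd_prime_iff_eq hq hp).1 hqp]
  obtain ⟨p0, hp0N, hp0⟩ := Nat.exists_infinite_primes N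
  obtain ⟨x0, hx0⟩ := IsAlgClosed.exists_pow_nat_eq (p0 : K) (n := 2) two_pos
  obtain ⟨g, hgF, hgO⟩ := sipf_galois F (O N) x0 (hprime p0 hp0 hp0N x0 hx0)
    (by
      rintro x ⟨a, ha0, hao, hap, hxa⟩ y ⟨b, hb0, hbo, hbp, hyb⟩ z ⟨c, hc0, hco, hcp, hzc⟩
      refine ⟨a * b * c, by positivity, ?_, ?_, ?_⟩
      · rw [cardFactors_mul (mul_ne_zero ha0 hb0) hc0, cardFactors_mul ha0 hb0]
        exact (hao.add_odd hbo).add_odd hco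
      · intro p hp hd
        rcases hp.dvd_mul.1 hd with hd | hd
        · rcases hp.dvd_mul.1 hd with hd | hd
          · exact hap p hp hd
          · exact hbp p hp hd
        · exact hcp p hp hd
      · rw [mul_pow, mul_pow, hxa, hyb, hzc]; push_cast; ring)
    (by
      rintro x ⟨a, -, -, -, hxa⟩
      exact ⟨a, by rw [hxa, map_natCast]⟩) hN
  exact ⟨g.toRingEquiv, fun a ha => hgF a (subset_adjoin k A ha), N,
    fun p hp hNp x hx => hgO x (hprime p hp hNp x hx)⟩

/-- A countable algebraically closed field of characteristic 0 of infinite transcendence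
degree over `ℚ` fails the small index property: there is a subgroup of its automorphism
group of finite index which contains no pointwise stabilizer of a finite set. -/
theorem not_smallIndexProperty_algClosedField (K : Type*) [Field K] [IsAlgClosed K]
    [CharZero K] [Countable K]
    (htr : ∃ s : ℕ → K, AlgebraicIndependent ℚ s) :
    ∃ H : Subgroup (K ≃+* K), H.FiniteIndex ∧
      ∀ A : Set K, A.Finite →
        ∃ g : K ≃+* K, (∀ a ∈ A, g a = a) ∧ g ∉ H := by
  obtain ⟨-, -⟩ := htr
  have hs : ∀ p : ℕ, ∃ x : K, x ^ 2 = (p : K) := fun p =>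
    IsAlgClosed.exists_pow_nat_eq (p : K) (n := 2) two_pos
  choose s hs using hs
  let r : ℕ → K := fun i => s (Nat.nth Nat.Prime i)
  have hr : ∀ i, r i ^ 2 = ((Nat.nth Nat.Prime i : ℕ) : K) := fun i => hs _
  have hpr : ∀ i, (Nat.nth Nat.Prime i).Prime := Nat.prime_nth_prime
  have hr0 : ∀ i, r i ≠ 0 := by
    intro i h
    have := hr i
    rw [h, zero_pow two_ne_zero] at this
    exact (hpr i).ne_zero (by exact_mod_cast this.symm)
  have hpm : ∀ (g : K ≃+* K) i, g (r i) = r i ∨ g (r i) = - r i := by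
    intro g i
    apply sq_eq_sq_iff_eq_or_eq_neg.1
    rw [← map_pow, hr, map_natCast]
  let U : Ultrafilter ℕ := Filter.hyperfilter ℕ
  let H : Subgroup (K ≃+* K) :=
    { carrier := {g | ∀ᶠ i in (U : Filter ℕ), g (r i) = r i}
      one_mem' := Filter.Eventually.of_forall fun i => rfl
      mul_mem' := by
        intro a b ha hb
        filter_upwards [ha, hb] with i h1 h2
        rw [RingAut.mul_apply, h2, h1]
      inv_mem' := by
        intro a ha
        filter_upwards [ha] with i h1
        exact (RingEquiv.symm_apply_eq a).2 h1.symm }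
  have hH : ∀ g : K ≃+* K, g ∈ H ↔ ∀ᶠ i in (U : Filter ℕ), g (r i) = r i := fun g => Iff.rfl
  have hH' : ∀ g : K ≃+* K, g ∉ H ↔ ∀ᶠ i in (U : Filter ℕ), g (r i) = - r i := by
    intro g
    rw [hH, ← Ultrafilter.eventually_not]
    refine Filter.eventually_congr (Filter.Eventually.of_forall fun i => ?_)
    constructor
    · exact (hpm g i).resolve_left
    · intro h h'
      rw [h'] at h
      exact hr0 i (self_eq_neg.1 h)
  have hA : ∀ A : Set K, A.Finite → ∃ g : K ≃+* K, (∀ a ∈ A, g a = a) ∧ g ∉ H := by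
    intro A hA
    obtain ⟨g, hg, N, hN⟩ := sipf_aut K A hA
    refine ⟨g, hg, (hH' g).2 ?_⟩
    have hev : ∀ᶠ i in Filter.atTop, g (r i) = - r i := by
      filter_upwards [Filter.eventually_ge_atTop N] with i hi
      exact hN _ (hpr i) (hi.trans (Nat.nth_strictMono Nat.infinite_setOfPred_prime).le_apply) _ (hr i)
    rw [← Nat.cofinite_eq_atTop] at hev
    exact Filter.hyperfilter_le_cofinite hev
  refine ⟨H, ?_, hA⟩
  obtain ⟨a, -, ha⟩ := hA ∅ Set.finite_empty
  have h2 : H.index = 2 := by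
    rw [Subgroup.index_eq_two_iff]
    refine ⟨a, fun b => ?_⟩
    by_cases hb : b ∈ H
    · refine Or.inr ⟨hb, fun hba => ha ?_⟩
      exact (Subgroup.mul_mem_cancel_left H hb).1 hba
    · refine Or.inl ⟨?_, hb⟩
      rw [hH]
      filter_upwards [(hH' a).1 ha, (hH' b).1 hb] with i h1 h2
      rw [RingAut.mul_apply, h1, map_neg, h2, neg_neg]
  exact ⟨by rw [h2]; exact two_ne_zero⟩
end

section
/- Let λ be an uncountable cardinal with λ^{<λ} = λ, let Ω be a set of cardinality λ, and let H be a subgroup of the symmetric group Sym(Ω) whose index in Sym(Ω) is at most λ. Then there exists a subset A ⊆ Ω of cardinality strictly less than λ such that the pointwise stabilizer of A is contained in H. -/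
universe u
open Cardinal Equiv
open scoped commutatorElement

theorem ext_perm {Ω : Type u} (S A : Set Ω) (φ : Ω → Ω) (hA : A ⊆ S)
    (hinj : Set.InjOn φ A) (hmap : Set.MapsTo φ A S)
    (h1 : #Ω ≤ #(S \ A : Set Ω)) (h2 : #Ω ≤ #(S \ φ '' A : Set Ω)) :
    ∃ π : Perm Ω, (∀ x ∈ A, π x = φ x) ∧ ∀ x ∉ S, π x = x := by
  classical
  have h3 : #(S \ A : Set Ω) = #(S \ φ '' A : Set Ω) :=
    le_antisymm ((mk_set_le _).trans h2) ((mk_set_le _).trans h1)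
  obtain ⟨e⟩ := Cardinal.eq.1 h3
  let F : Ω → Ω := fun x => if x ∈ A then φ x else if h : x ∈ S \ A then e ⟨x, h⟩ else x
  have F1 : ∀ x ∈ A, F x = φ x := fun x hx => by simp [F, hx]
  have F2 : ∀ x (h : x ∈ S \ A), F x = e ⟨x, h⟩ := fun x hx => by
    simp only [F, hx.2, if_false]; rw [dif_pos hx]
  have F3 : ∀ x, x ∉ S → F x = x := fun x hx => by
    have : x ∉ A := fun h => hx (hA h)
    simp [F, hx, this]
  have em : ∀ y, (e y : Ω) ∈ S \ φ '' A := fun y => (e y).2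
  have bij : Function.Bijective F := by
    constructor
    · intro x y hxy
      have einj : ∀ a b, (e a : Ω) = e b → a = b := fun a b h => e.injective (Subtype.ext h)
      rcases em' (x ∈ S) with hx | hx <;> rcases em' (y ∈ S) with hy | hy
      · rwa [F3 x hx, F3 y hy] at hxy
      · exfalso
        rw [F3 x hx] at hxy
        by_cases hy' : y ∈ A
        · rw [F1 y hy'] at hxy; exact hx (hxy ▸ hmap hy')
        · rw [F2 y ⟨hy, hy'⟩] at hxy; exact hx (hxy ▸ (em _).1)
      · exfalso
        rw [F3 y hy] at hxy
        by_cases hy' : x ∈ A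
        · rw [F1 x hy'] at hxy; exact hy (hxy ▸ hmap hy')
        · rw [F2 x ⟨hx, hy'⟩] at hxy; exact hy (hxy ▸ (em _).1)
      · by_cases hx' : x ∈ A <;> by_cases hy' : y ∈ A
        · rw [F1 x hx', F1 y hy'] at hxy; exact hinj hx' hy' hxy
        · rw [F1 x hx', F2 y ⟨hy, hy'⟩] at hxy
          exact absurd ⟨x, hx', hxy⟩ (em _).2
        · rw [F1 y hy', F2 x ⟨hx, hx'⟩] at hxy
          exact absurd ⟨y, hy', hxy.symm⟩ (em _).2
        · rw [F2 x ⟨hx, hx'⟩, F2 y ⟨hy, hy'⟩] at hxy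
          exact congrArg Subtype.val (einj _ _ hxy)
    · intro y
      by_cases hy : y ∈ S
      · by_cases hy' : y ∈ φ '' A
        · obtain ⟨x, hx, rfl⟩ := hy'
          exact ⟨x, F1 x hx⟩
        · refine ⟨e.symm ⟨y, hy, hy'⟩, ?_⟩
          rw [F2 _ (e.symm ⟨y, hy, hy'⟩).2]
          simp
      · exact ⟨y, F3 y hy⟩
  exact ⟨Equiv.ofBijective F bij, F1, F3⟩

/-- split a set of full size into two sets of full size -/
theorem split_set {Ω : Type u} [Infinite Ω] (C : Set Ω) (hC : #Ω ≤ #C) :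
    ∃ C1 ⊆ C, #Ω ≤ #C1 ∧ #Ω ≤ #(C \ C1 : Set Ω) := by
  have : #(Ω ⊕ Ω) ≤ #C := by
    rw [mk_sum, lift_id, add_eq_self (aleph0_le_mk Ω)]; exact hC
  obtain ⟨e⟩ := this
  refine ⟨Set.range fun a => (e (.inl a) : Ω), ?_, ?_, ?_⟩
  · rintro _ ⟨a, rfl⟩; exact (e _).2
  · refine (mk_range_eq _ ?_).ge
    intro a b h
    simpa using e.injective (Subtype.ext h)
  · refine ⟨⟨fun a => ⟨e (.inr a), (e _).2, ?_⟩, ?_⟩⟩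
    · rintro ⟨b, hb⟩
      simpa using e.injective (Subtype.ext hb)
    · intro a b h
      have h' := Subtype.ext_iff.1 h
      simpa using e.injective (Subtype.ext h')

theorem gen_main {Ω : Type u} [Infinite Ω] (G : Subgroup (Perm Ω)) (S1 S2 : Set Ω)
    (h1 : ∀ π : Perm Ω, (∀ x ∉ S1, π x = x) → π ∈ G)
    (h2 : ∀ π : Perm Ω, (∀ x ∉ S2, π x = x) → π ∈ G)
    (hC : #Ω ≤ #(S1 ∩ S2 : Set Ω)) (f : Perm Ω) (hf : ∀ x ∉ S1 ∪ S2, f x = x)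
    (hf2 : #Ω ≤ #(f '' S1 ∩ S2 : Set Ω)) : f ∈ G := by
  classical
  obtain ⟨C1, hC1, c1, c2⟩ := split_set _ hC
  have : #(S2 \ S1 : Set Ω) ≤ #C1 := (mk_set_le _).trans c1
  obtain ⟨j0⟩ := this
  let j : Ω → Ω := fun x => if h : x ∈ S2 \ S1 then j0 ⟨x, h⟩ else x
  have hj : ∀ x ∈ S2 \ S1, j x ∈ C1 := fun x hx => by
    simp only [j]; rw [dif_pos hx]; exact (j0 _).2
  have jinj : Set.InjOn j (S2 \ S1) := by
    intro x hx y hy h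
    simp only [j] at h; rw [dif_pos hx, dif_pos hy] at h
    exact congrArg Subtype.val (j0.injective (Subtype.ext h))
  have fmap : ∀ x ∈ S1 ∪ S2, f x ∈ S1 ∪ S2 := by
    intro x hx
    by_contra h
    have := hf _ h
    rw [f.injective this] at h
    exact h hx
  obtain ⟨s, sA, sB⟩ := ext_perm S2 (S2 \ S1) j Set.sdiff_subset jinj
    (fun x hx => (hC1 (hj x hx)).2)
    (hC.trans (mk_le_mk_of_subset (by intro x hx; exact ⟨hx.2, fun h => h.2 hx.1⟩)))
    (c2.trans (mk_le_mk_of_subset (by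
      rintro x hx; refine ⟨hx.1.2, ?_⟩; rintro ⟨y, hy, rfl⟩; exact hx.2 (hj y hy))))
  -- `t`
  let φ : Ω → Ω := fun x => if f (s.symm x) ∈ S2 then x else f (s.symm x)
  have φj : ∀ d ∈ S2 \ S1, φ (j d) = if f d ∈ S2 then j d else f d := by
    intro d hd
    have : s.symm (j d) = d := by rw [← sA d hd]; simp
    simp only [φ, this]
  have fS1 : ∀ d ∈ S2 \ S1, f d ∉ S2 → f d ∈ S1 := by
    intro d hd h
    exact (fmap d (Or.inr hd.1)).resolve_right h
  obtain ⟨t, tA, tB⟩ := ext_perm S1 (j '' (S2 \ S1)) φ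
    (by rintro _ ⟨d, hd, rfl⟩; exact (hC1 (hj d hd)).1)
    (by
      rintro _ ⟨d, hd, rfl⟩ _ ⟨d', hd', rfl⟩ h
      rw [φj d hd, φj d' hd'] at h
      split_ifs at h with ha hb hb
      · exact h
      · exact absurd (h ▸ (hC1 (hj d hd)).2) hb
      · exact absurd (h ▸ (hC1 (hj d' hd')).2) ha
      · rw [f.injective h])
    (by
      rintro _ ⟨d, hd, rfl⟩
      rw [φj d hd]
      split_ifs with ha
      · exact (hC1 (hj d hd)).1
      · exact fS1 d hd ha)
    (c2.trans (mk_le_mk_of_subset (by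
      rintro x hx; refine ⟨hx.1.1, ?_⟩; rintro ⟨y, hy, rfl⟩; exact hx.2 (hj y hy))))
    (c2.trans (mk_le_mk_of_subset (by
      rintro x hx; refine ⟨hx.1.1, ?_⟩; rintro ⟨_, ⟨d, hd, rfl⟩, h⟩
      rw [φj d hd] at h
      split_ifs at h with ha
      · exact hx.2 (h ▸ hj d hd)
      · exact ha (h ▸ hx.1.2))))
  obtain ⟨r, rA, rB⟩ := ext_perm S2 (j '' {d | d ∈ S2 \ S1 ∧ f d ∈ S2}) (fun x => f (s.symm x))
    (by rintro _ ⟨d, hd, rfl⟩; exact (hC1 (hj d hd.1)).2)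
    (fun x _ y _ h => s.symm.injective (f.injective h))
    (by
      rintro _ ⟨d, hd, rfl⟩
      have : s.symm (j d) = d := by rw [← sA d hd.1]; simp
      simp only [this]; exact hd.2)
    (c2.trans (mk_le_mk_of_subset (by
      rintro x hx; refine ⟨hx.1.2, ?_⟩; rintro ⟨y, hy, rfl⟩; exact hx.2 (hj y hy.1))))
    (hf2.trans (mk_le_mk_of_subset (by
      rintro _ ⟨⟨x, hx, rfl⟩, hx2⟩; refine ⟨hx2, ?_⟩
      rintro ⟨_, ⟨d, hd, rfl⟩, h⟩
      have : s.symm (j d) = d := by rw [← sA d hd.1]; simp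
      simp only [this] at h
      exact hd.1.2 (f.injective h ▸ hx))))
  have key : ∀ d ∈ S2 \ S1, r (t (s d)) = f d := by
    intro d hd
    have hs : s.symm (j d) = d := by rw [← sA d hd]; simp
    rw [sA d hd, tA _ ⟨d, hd, rfl⟩, φj d hd]
    split_ifs with ha
    · rw [rA _ ⟨d, ⟨hd, ha⟩, rfl⟩, hs]
    · exact rB _ ha
  have hk : r * t * s ∈ G := G.mul_mem (G.mul_mem (h2 r rB) (h1 t tB)) (h2 s sB)
  have : (r * t * s)⁻¹ * f ∈ G := by
    apply h1
    intro x hx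
    rw [Perm.mul_apply, Perm.inv_eq_iff_eq]
    by_cases hx2 : x ∈ S2
    · exact (key x ⟨hx2, hx⟩).symm
    · rw [hf x (by simp [hx, hx2])]
      simp [sB x hx2, tB x hx, rB x hx2]
  exact (G.mul_mem_cancel_left (G.inv_mem hk)).1 this

theorem gen_union {Ω : Type u} [Infinite Ω] (G : Subgroup (Perm Ω)) (S1 S2 : Set Ω)
    (h1 : ∀ π : Perm Ω, (∀ x ∉ S1, π x = x) → π ∈ G)
    (h2 : ∀ π : Perm Ω, (∀ x ∉ S2, π x = x) → π ∈ G)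
    (hC : #Ω ≤ #(S1 ∩ S2 : Set Ω)) (f : Perm Ω) (hf : ∀ x ∉ S1 ∪ S2, f x = x) : f ∈ G := by
  classical
  by_cases hf2 : #Ω ≤ #(f '' S1 ∩ S2 : Set Ω)
  · exact gen_main G S1 S2 h1 h2 hC f hf hf2
  have fmap : ∀ x ∈ S1 ∪ S2, f x ∈ S1 ∪ S2 := by
    intro x hx
    by_contra h
    have := hf _ h
    rw [f.injective this] at h
    exact h hx
  have hf1 : #Ω ≤ #(f '' S1 ∩ S1 : Set Ω) := by
    by_contra h
    have hlt := add_lt_of_lt (aleph0_le_mk Ω) (not_le.1 h) (not_le.1 hf2)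
    have e1 : #(f '' S1 : Set Ω) = #S1 := mk_image_eq f.injective
    have e2 : #Ω ≤ #S1 := hC.trans (mk_le_mk_of_subset Set.inter_subset_left)
    have e3 : #(f '' S1 : Set Ω) ≤ #(f '' S1 ∩ S1 : Set Ω) + #(f '' S1 ∩ S2 : Set Ω) := by
      refine (mk_le_mk_of_subset ?_).trans (mk_union_le _ _)
      rintro _ ⟨x, hx, rfl⟩
      rcases fmap x (Or.inl hx) with h | h
      · exact Or.inl ⟨⟨x, hx, rfl⟩, h⟩
      · exact Or.inr ⟨⟨x, hx, rfl⟩, h⟩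
    rw [e1] at e3
    exact absurd (e2.trans e3) (not_le.2 hlt)
  obtain ⟨M, hM, m1, m2⟩ := split_set _ hf1
  obtain ⟨C1, hC1, c1, c2⟩ := split_set _ hC
  have : #M = #C1 := le_antisymm ((mk_set_le _).trans c1) ((mk_set_le _).trans m1)
  obtain ⟨e⟩ := Cardinal.eq.1 this
  let φ : Ω → Ω := fun x => if h : x ∈ M then e ⟨x, h⟩ else x
  have φ1 : ∀ x (h : x ∈ M), φ x = e ⟨x, h⟩ := fun x h => dif_pos h
  have φ2 : ∀ x ∈ M, φ x ∈ C1 := fun x h => by rw [φ1 x h]; exact (e _).2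
  have φinj : Set.InjOn φ M := by
    intro x hx y hy h
    rw [φ1 x hx, φ1 y hy] at h
    exact congrArg Subtype.val (e.injective (Subtype.ext h))
  obtain ⟨w, wA, wB⟩ := ext_perm S1 M φ (fun x hx => (hM hx).2)
    φinj (fun x hx => (hC1 (φ2 x hx)).1)
    (m2.trans (mk_le_mk_of_subset fun x hx => ⟨hx.1.2, hx.2⟩))
    (c2.trans (mk_le_mk_of_subset (by
      rintro x hx; refine ⟨hx.1.1, ?_⟩; rintro ⟨y, hy, rfl⟩; exact hx.2 (φ2 y hy))))
  have hw : w ∈ G := h1 w wB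
  have : w * f ∈ G := by
    apply gen_main G S1 S2 h1 h2 hC
    · intro x hx
      rw [Perm.mul_apply, hf x hx, wB x (fun h => hx (Or.inl h))]
    · have : #(φ '' M : Set Ω) = #M := mk_image_eq_of_injOn _ _ φinj
      refine (m1.trans this.ge).trans (mk_le_mk_of_subset ?_)
      rintro _ ⟨y, hy, rfl⟩
      refine ⟨?_, (hC1 (φ2 y hy)).2⟩
      obtain ⟨x, hx, hxy⟩ := (hM hy).1
      exact ⟨x, hx, by rw [Perm.mul_apply, hxy, wA y hy]⟩
  exact (G.mul_mem_cancel_left hw).1 this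

/-- product permutation -/
def pcr {I J : Type u} : (I → Perm J) →* Perm (I × J) where
  toFun x := Equiv.prodCongrRight x
  map_one' := by ext ⟨a, b⟩ <;> simp
  map_mul' x y := by ext ⟨a, b⟩ <;> simp

@[simp] theorem pcr_apply {I J : Type u} (x : I → Perm J) (p : I × J) :
    pcr x p = (p.1, x p.1 p.2) := rfl

theorem diag {I J Ω : Type u} (G : Subgroup (Perm Ω)) (φ : I × J ↪ Ω)
    (c : I → Perm Ω ⧸ G) (hc : Function.Surjective c) :
    ∃ i, ∀ y : Perm J, ∃ x : I → Perm J, x i = y ∧ Perm.viaEmbeddingHom φ (pcr x) ∈ G := by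
  have h : ∃ i, ∀ y : Perm J, ∃ x : I → Perm J, x i = y ∧
      (QuotientGroup.mk (Perm.viaEmbeddingHom φ (pcr x)) : Perm Ω ⧸ G) = c i := by
    by_contra! h
    choose y hy using h
    obtain ⟨i, hi⟩ := hc (QuotientGroup.mk (Perm.viaEmbeddingHom φ (pcr y)))
    exact hy i y rfl hi.symm
  obtain ⟨i, hi⟩ := h
  refine ⟨i, fun y => ?_⟩
  obtain ⟨x1, h1, k1⟩ := hi 1
  obtain ⟨x2, h2, k2⟩ := hi y
  refine ⟨x1⁻¹ * x2, by simp [h1, h2], ?_⟩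
  rw [map_mul, map_mul, map_inv, map_inv]
  exact QuotientGroup.eq.1 (k1.trans k2.symm)

/-- act by `f` on nonnegative levels -/
def halfPerm {I : Type u} (f : Perm I) : Perm (I × ULift.{u} ℤ) where
  toFun p := if 0 ≤ p.2.down then (f p.1, p.2) else p
  invFun p := if 0 ≤ p.2.down then (f.symm p.1, p.2) else p
  left_inv p := by by_cases h : 0 ≤ p.2.down <;> simp [h]
  right_inv p := by by_cases h : 0 ≤ p.2.down <;> simp [h]

def shiftPerm (I : Type u) : Perm (I × ULift.{u} ℤ) where
  toFun p := (p.1, ⟨p.2.down + 1⟩)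
  invFun p := (p.1, ⟨p.2.down - 1⟩)
  left_inv p := by simp
  right_inv p := by simp

theorem comm_half {I : Type u} (f : Perm I) (p : I × ULift.{u} ℤ) :
    ⁅halfPerm f, shiftPerm I⁆ p = if p.2.down = 0 then (f p.1, p.2) else p := by
  have e1 : ∀ q, (halfPerm f)⁻¹ q = if 0 ≤ q.2.down then (f.symm q.1, q.2) else q := fun _ => rfl
  have e2 : ∀ q, (shiftPerm I)⁻¹ q = (q.1, ⟨q.2.down - 1⟩) := fun _ => rfl
  have e3 : ∀ q, (halfPerm f) q = if 0 ≤ q.2.down then (f q.1, q.2) else q := fun _ => rfl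
  have e4 : ∀ q, (shiftPerm I) q = (q.1, ⟨q.2.down + 1⟩) := fun _ => rfl
  obtain ⟨a, ⟨n⟩⟩ := p
  rw [commutatorElement_def]
  simp only [Perm.mul_apply, e1, e2, e3, e4]
  rcases lt_trichotomy n 0 with h | h | h
  · have h1 : ¬ (0 ≤ n - 1) := by omega
    have h2 : ¬ (0 ≤ n) := by omega
    have h3 : n ≠ 0 := by omega
    simp only [if_neg h1, sub_add_cancel, if_neg h2, if_neg h3]
  · subst h; simp
  · have h1 : 0 ≤ n - 1 := by omega
    have h2 : 0 ≤ n := by omega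
    have h3 : n ≠ 0 := by omega
    simp only [if_pos h1, sub_add_cancel, if_pos h2, if_neg h3, Equiv.apply_symm_apply]

theorem exists_full {Ω : Type u} [Infinite Ω] (G : Subgroup (Perm Ω))
    (hG : #(Perm Ω ⧸ G) ≤ #Ω) :
    ∃ S : Set Ω, #Ω ≤ #S ∧ #Ω ≤ #(Sᶜ : Set Ω) ∧
      ∀ π : Perm Ω, (∀ x ∉ S, π x = x) → π ∈ G := by
  classical
  have hne : Nonempty (Perm Ω ⧸ G) := ⟨QuotientGroup.mk 1⟩
  obtain ⟨g⟩ := hG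
  let c : Ω → Perm Ω ⧸ G := Function.invFun g
  have hc : Function.Surjective c := Function.invFun_surjective g.injective
  have hcard : #(Ω × (Ω × (Ω × ULift.{u} ℤ))) = #Ω := by
    have := aleph0_le_mk Ω
    simp [mul_eq_self this, mul_aleph0_eq this]
  obtain ⟨φ⟩ := Cardinal.eq.1 hcard
  obtain ⟨i, hi⟩ := diag G φ.toEmbedding c hc
  let ψ : Ω × (Ω × ULift.{u} ℤ) ↪ Ω := ⟨fun a => φ (i, a), fun a b h => by simpa using h⟩
  obtain ⟨i', hi'⟩ := diag G ψ c hc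
  have hψ : ∀ q, Perm.viaEmbeddingHom ψ q =
      Perm.viaEmbeddingHom φ.toEmbedding (pcr (Pi.mulSingle i q)) := by
    intro q
    ext p
    obtain ⟨⟨a, b⟩, rfl⟩ := φ.surjective p
    have e1 : Perm.viaEmbeddingHom φ.toEmbedding (pcr (Pi.mulSingle i q)) (φ (a, b)) = _ :=
      Perm.viaEmbedding_apply _ φ.toEmbedding (a, b)
    rw [e1]
    by_cases h : a = i
    · subst h
      have e2 : Perm.viaEmbeddingHom ψ q (φ (a, b)) = _ := Perm.viaEmbedding_apply _ ψ b
      rw [e2]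
      simp only [pcr_apply, Pi.mulSingle_eq_same]
      rfl
    · have e2 : Perm.viaEmbeddingHom ψ q (φ (a, b)) = _ :=
        Perm.viaEmbedding_apply_of_notMem _ ψ _ (by
          rintro ⟨b', hb'⟩
          have := φ.injective hb'
          simp only [Prod.mk.injEq] at this
          exact h this.1.symm)
      rw [e2]
      simp [h]
  let θ : Ω → Ω := fun a => φ (i, i', a, ⟨0⟩)
  have θinj : Function.Injective θ := fun a b h => by simpa [θ] using h
  refine ⟨Set.range θ, (mk_range_eq _ θinj).ge, ?_, ?_⟩
  · refine ⟨⟨fun a => ⟨φ (i, i', a, ⟨1⟩), ?_⟩, ?_⟩⟩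
    · rintro ⟨b, hb⟩
      simpa using φ.injective hb
    · intro a b h
      have h' := congrArg Subtype.val h
      simpa using φ.injective h'
  · intro π hπ
    have πmap : ∀ a, π (θ a) ∈ Set.range θ := by
      intro a
      by_contra h
      have := hπ _ h
      rw [π.injective this] at h
      exact h ⟨a, rfl⟩
    have πmap' : ∀ a, π.symm (θ a) ∈ Set.range θ := by
      intro a
      by_contra h
      have := hπ _ h
      rw [Equiv.apply_symm_apply] at this
      rw [← this] at h
      exact h ⟨a, rfl⟩
    choose f0 hf0 using πmap
    choose f1 hf1 using πmap'
    let f : Perm Ω := ⟨f0, f1, fun a => θinj (by rw [hf1, hf0]; simp),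
      fun a => θinj (by rw [hf0, hf1]; simp)⟩
    obtain ⟨x, hx, hxG⟩ := hi' (halfPerm f)
    obtain ⟨w, hw, hwG⟩ := hi (pcr (Pi.mulSingle i' (shiftPerm Ω)))
    have hcomm : ⁅Perm.viaEmbeddingHom ψ (pcr x), Perm.viaEmbeddingHom φ.toEmbedding (pcr w)⁆ ∈ G := by
      rw [commutatorElement_def]
      exact G.mul_mem (G.mul_mem (G.mul_mem hxG hwG) (G.inv_mem hxG)) (G.inv_mem hwG)
    have c1 : ⁅(Pi.mulSingle i (pcr x) : Ω → Perm (Ω × (Ω × ULift.{u} ℤ))), w⁆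
        = Pi.mulSingle i (pcr (Pi.mulSingle i' ⁅halfPerm f, shiftPerm Ω⁆)) := by
      funext a
      by_cases h : a = i
      · subst h
        have c2 : ⁅x, Pi.mulSingle i' (shiftPerm Ω)⁆
          = (Pi.mulSingle i' ⁅halfPerm f, shiftPerm Ω⁆ : Ω → Perm (Ω × ULift.{u} ℤ)) := by
          funext a'
          by_cases h' : a' = i'
          · subst h'
            simp [commutatorElement_def, hx]
          · simp [commutatorElement_def, h']
        rw [Pi.mulSingle_eq_same, ← c2, map_commutatorElement, ← hw]
        simp [commutatorElement_def]
      · simp [commutatorElement_def, h]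
    rw [hψ, ← map_commutatorElement, ← map_commutatorElement, c1] at hcomm
    convert hcomm
    ext p
    obtain ⟨⟨a, b, d, ⟨n⟩⟩, rfl⟩ := φ.surjective p
    have e1 : ∀ z : Ω → Perm (Ω × (Ω × ULift.{u} ℤ)),
        Perm.viaEmbeddingHom φ.toEmbedding (pcr z) (φ (a, b, d, ⟨n⟩)) =
          φ (pcr z (a, b, d, ⟨n⟩)) :=
      fun z => Perm.viaEmbedding_apply _ φ.toEmbedding _
    rw [e1]
    by_cases h : a = i ∧ b = i' ∧ n = 0
    · obtain ⟨rfl, rfl, rfl⟩ := h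
      have : π (φ (a, b, d, ⟨0⟩)) = φ (a, b, f d, ⟨0⟩) := (hf0 d).symm
      rw [this]
      simp [comm_half]
    · rw [hπ _ (by
        rintro ⟨d', hd'⟩
        have := φ.injective hd'
        simp only [Prod.mk.injEq, ULift.up.injEq] at this
        exact h ⟨this.1.symm, this.2.1.symm, this.2.2.2.symm⟩)]
      congr 1
      by_cases h1 : a = i
      · subst h1
        by_cases h2 : b = i'
        · subst h2
          have : n ≠ 0 := by tauto
          simp [comm_half, this]
        · simp [h2]
      · simp [h1]

theorem exists_ad {Ω : Type u} [Infinite Ω] (hpow : #Ω ^< #Ω = #Ω) :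
    ∃ (B : Type u) (A : B → Set Ω) (R : Set Ω), #Ω < #B ∧ #Ω ≤ #R ∧ (∀ b, #Ω ≤ #(A b)) ∧
      (∀ b, Disjoint (A b) R) ∧ ∀ b c, b ≠ c → #(A b ∩ A c : Set Ω) < #Ω := by
  classical
  obtain ⟨_, _, ho⟩ := exists_ord_eq_type_lt Ω
  have hinf := aleph0_le_mk Ω
  let T : Type u := Σ a : Ω, (Set.Iio a → Bool)
  have hT : #T ≤ #Ω := by
    rw [mk_sigma]
    refine (sum_le_mk_mul_iSup _).trans ?_
    refine (mul_le_mul_right (ciSup_le' fun a => ?_) _).trans (mul_eq_self hinf).le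
    have h1 : #(Set.Iio a) < #Ω := mk_Iio_lt a ho
    calc #(Set.Iio a → Bool) = 2 ^ #(Set.Iio a) := by simp
      _ ≤ #Ω ^ #(Set.Iio a) := power_le_power_right ((natCast_lt_aleph0 (n := 2)).le.trans hinf)
      _ ≤ #Ω ^< #Ω := le_powerlt _ h1
      _ = #Ω := hpow
  have hs : #(T ⊕ Ω) ≤ #Ω := by
    rw [mk_sum, lift_id, lift_id]
    exact (add_le_add hT le_rfl).trans (add_eq_self hinf).le
  obtain ⟨e⟩ := hs
  let node : (Ω → Bool) → Ω → Ω := fun b a => e (.inl ⟨a, fun x => b x⟩)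
  have hnode : ∀ b c a a', node b a = node c a' → a = a' ∧ ∀ x < a, b x = c x := by
    intro b c a a' h
    have h := e.injective h
    simp only [Sum.inl.injEq] at h
    have h1 : a = a' := congrArg Sigma.fst h
    subst h1
    refine ⟨rfl, fun x hx => ?_⟩
    simp only [T, Sigma.mk.injEq, heq_eq_eq, true_and] at h
    exact congrFun h ⟨x, hx⟩
  refine ⟨Ω → Bool, fun b => Set.range (node b), Set.range fun a => e (.inr a), ?_, ?_, ?_, ?_, ?_⟩
  · simpa using cantor #Ω
  · exact (mk_range_eq _ (fun a b h => by simpa using h)).ge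
  · intro b
    exact (mk_range_eq _ (fun a a' h => (hnode b b a a' h).1)).ge
  · intro b
    rw [Set.disjoint_left]
    rintro _ ⟨a, rfl⟩ ⟨a', h⟩
    simpa using e.injective h
  · intro b c hbc
    obtain ⟨x, hx⟩ := Function.ne_iff.1 hbc
    have : (Set.range (node b) ∩ Set.range (node c)) ⊆ node b '' Set.Iic x := by
      rintro _ ⟨⟨a, rfl⟩, ⟨a', h⟩⟩
      refine ⟨a, ?_, rfl⟩
      by_contra hax
      exact hx ((hnode b c a a' h.symm).2 x (not_le.1 hax))
    exact ((mk_le_mk_of_subset this).trans mk_image_le).trans_lt (mk_Iic_lt x ho hinf)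

theorem smallIndex_aux {Ω : Type u} [Infinite Ω] (hpow : #Ω ^< #Ω = #Ω)
    (G : Subgroup (Perm Ω)) (hG : #(Perm Ω ⧸ G) ≤ #Ω) :
    ∃ A : Set Ω, #A < #Ω ∧ ∀ g : Perm Ω, (∀ a ∈ A, g a = a) → g ∈ G := by
  classical
  obtain ⟨S, s1, s2, hS⟩ := exists_full G hG
  obtain ⟨B, A, R, hB, hR, hA, hAR, hAA⟩ := exists_ad hpow
  have hx : ∀ b, ∃ x : Perm Ω, ∀ p, x p ∈ A b ↔ p ∉ S := by
    intro b
    have k1 : #(Sᶜ : Set Ω) = #(A b) :=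
      le_antisymm ((mk_set_le _).trans (hA b)) ((mk_set_le _).trans s2)
    have k2 : #((Sᶜ)ᶜ : Set Ω) = #((A b)ᶜ : Set Ω) := by
      rw [compl_compl]
      refine le_antisymm ((mk_set_le _).trans (hR.trans (mk_le_mk_of_subset ?_)))
        ((mk_set_le _).trans s1)
      exact (hAR b).subset_compl_left
    obtain ⟨e1⟩ := Cardinal.eq.1 k1
    obtain ⟨e2⟩ := Cardinal.eq.1 k2
    let x : Perm Ω := (Equiv.Set.sumCompl (Sᶜ)).symm.trans
      ((Equiv.sumCongr e1 e2).trans (Equiv.Set.sumCompl (A b)))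
    refine ⟨x, fun p => ?_⟩
    by_cases hp : p ∈ S
    · have : x p = e2 ⟨p, by simpa using hp⟩ := by
        simp only [x, Equiv.trans_apply]
        rw [Equiv.Set.sumCompl_symm_apply_of_notMem (by simpa using hp)]
        rfl
      rw [this]
      exact iff_of_false (e2 _).2 (by simpa using hp)
    · have : x p = e1 ⟨p, hp⟩ := by
        simp only [x, Equiv.trans_apply]
        rw [Equiv.Set.sumCompl_symm_apply_of_mem (by simpa using hp)]
        rfl
      rw [this]
      exact iff_of_true (e1 _).2 hp
  choose x hx using hx
  have : ∃ b c, b ≠ c ∧ (QuotientGroup.mk (x b) : Perm Ω ⧸ G) = QuotientGroup.mk (x c) := by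
    by_contra! h
    have hinj : Function.Injective fun b => (QuotientGroup.mk (x b) : Perm Ω ⧸ G) := by
      intro b c hbc
      by_contra hne
      exact h b c hne hbc
    exact absurd ((mk_le_of_injective hinj).trans hG) (not_le.2 hB)
  obtain ⟨b, c, hbc, hq⟩ := this
  set g : Perm Ω := (x b)⁻¹ * x c with hg
  have hgG : g ∈ G := QuotientGroup.eq.1 hq
  have hxg : ∀ p, x b (g p) = x c p := fun p => by simp [hg]
  let S2 : Set Ω := {p | g p ∈ S}
  refine ⟨(S ∪ S2)ᶜ, ?_, ?_⟩
  · refine lt_of_le_of_lt ?_ (hAA b c hbc)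
    rw [← mk_image_eq (s := (S ∪ S2)ᶜ) (x c).injective]
    apply mk_le_mk_of_subset
    rintro _ ⟨p, hp, rfl⟩
    simp only [Set.mem_compl_iff, Set.mem_union, not_or] at hp
    refine ⟨?_, (hx c p).2 hp.1⟩
    rw [← hxg]
    exact (hx b _).2 hp.2
  · intro f hf
    apply gen_union G S S2 hS ?_ ?_ f (fun p hp => hf p hp)
    · intro π hπ
      have : g * π * g⁻¹ ∈ G := by
        apply hS
        intro p hp
        have : π (g⁻¹ p) = g⁻¹ p := hπ _ (by simpa [S2] using hp)
        rw [Perm.mul_apply, Perm.mul_apply, this, ← Perm.mul_apply, mul_inv_cancel, Perm.one_apply]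
      have h2 := G.mul_mem (G.mul_mem (G.inv_mem hgG) this) hgG
      convert h2 using 1
      group
    · rw [← mk_image_eq (s := S ∩ S2) (x c).injective]
      refine hR.trans (mk_le_mk_of_subset fun r hr => ?_)
      refine ⟨(x c).symm r, ⟨?_, ?_⟩, by simp⟩
      · by_contra h
        have := (hx c _).2 h
        rw [Equiv.apply_symm_apply] at this
        exact Set.disjoint_left.1 (hAR c) this hr
      · by_contra h
        have := (hx b _).2 h
        rw [hxg, Equiv.apply_symm_apply] at this
        exact Set.disjoint_left.1 (hAR b) this hr

theorem smallIndex_sym_uncountable (lam : Cardinal.{u}) (hlam : Cardinal.aleph0 < lam)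
    (hpow : lam ^< lam = lam) (Ω : Type u) (hΩ : Cardinal.mk Ω = lam)
    (H : Subgroup (Equiv.Perm Ω))
    (hindex : Cardinal.mk (Equiv.Perm Ω ⧸ H) ≤ lam) :
    ∃ A : Set Ω, Cardinal.mk A < lam ∧
      ∀ g : Equiv.Perm Ω, (∀ a ∈ A, g a = a) → g ∈ H := by
  subst hΩ
  have : Infinite Ω := infinite_iff.2 hlam.le
  exact smallIndex_aux hpow H hindex
end
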